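/- arXiv:2008.01428 — 3 statements merged into one kernel-verified Lean document; each statement's English description precedes it below -/
import Mathlib

section
/- Let 0 < a < b be integers, D = gcd(a,b), and k_{a,b} = max{b·((b−a)/D − 1), a·b/D}. For an integer j ≥ 1 let H_j denote the additive submonoid of ℕ generated by {j, j+a, j+b}. Then res(H_j) = res(H_{j+b}) for all j > 2k_{a,b}. -/
namespace NumSgp

/-- A numerical semigroup: an additive submonoid of ℕ with finite complement. -/
def IsNumSgp (H : Set ℕ) : Prop :=
  0 ∈ H ∧ (∀ a ∈ H, ∀ b ∈ H, a + b ∈ H) ∧ Hᶜ.Finite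

/-- Membership of an integer in (the image in ℤ of) `H ⊆ ℕ`. -/
def memZ (H : Set ℕ) (z : ℤ) : Prop := ∃ n ∈ H, (n : ℤ) = z

/-- The Frobenius number: the largest integer not in `H`. -/
noncomputable def frob (H : Set ℕ) : ℤ := sSup {z : ℤ | ¬ memZ H z}

/-- The pseudo-Frobenius numbers of `H`. -/
def pseudoFrob (H : Set ℕ) : Set ℤ :=
  {f : ℤ | ¬ memZ H f ∧ ∀ m ∈ H, m ≠ 0 → memZ H (f + (m : ℤ))}

/-- The canonical ideal `Ω_H = {-f + h : f ∈ PF(H), h ∈ H}`. -/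
def canIdeal (H : Set ℕ) : Set ℤ :=
  {z : ℤ | ∃ f ∈ pseudoFrob H, ∃ h ∈ H, z = -f + (h : ℤ)}

/-- The anti-canonical ideal `Ω_H⁻¹ = {x : x + Ω_H ⊆ H}`. -/
def antiCanIdeal (H : Set ℕ) : Set ℤ :=
  {x : ℤ | ∀ w ∈ canIdeal H, memZ H (x + w)}

/-- The trace of `H`: the sumset `Ω_H + Ω_H⁻¹`. -/
def trace (H : Set ℕ) : Set ℤ :=
  {z : ℤ | ∃ w ∈ canIdeal H, ∃ x ∈ antiCanIdeal H, z = w + x}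

/-- The conductor ideal `C_H = {x : x > Fr(H)}` (viewed inside ℤ). -/
noncomputable def condIdeal (H : Set ℕ) : Set ℤ := {z : ℤ | frob H < z}

/-- The residue of `H`: `|H ∖ tr(H)|`. -/
noncomputable def res (H : Set ℕ) : ℕ :=
  Set.ncard {h : ℕ | h ∈ H ∧ (h : ℤ) ∉ trace H}

/-- The number of gaps `g(H)`. -/
noncomputable def gaps (H : Set ℕ) : ℕ := Set.ncard Hᶜ

/-- The number of non-gaps below the Frobenius number, `n(H)`. -/
noncomputable def nongaps (H : Set ℕ) : ℕ :=
  Set.ncard {x : ℕ | x ∈ H ∧ (x : ℤ) < frob H}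

/-- `H` is symmetric if for all `x ∈ ℤ`, `x ∈ H` or `Fr(H) - x ∈ H`. -/
noncomputable def IsSymmetric (H : Set ℕ) : Prop :=
  ∀ z : ℤ, memZ H z ∨ memZ H (frob H - z)

/-- `H` is nearly Gorenstein if `M = H ∖ {0} ⊆ tr(H)`. -/
def NearlyGorenstein (H : Set ℕ) : Prop :=
  ∀ h ∈ H, h ≠ 0 → (h : ℤ) ∈ trace H

/-- The submonoid of ℕ generated by a set. -/
def genBy (A : Set ℕ) : Set ℕ := (AddSubmonoid.closure A : Set ℕ)

end NumSgp

open NumSgp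


/-- The gcd of the elements of a set `S ⊆ ℕ` (the greatest common divisor,
realized as the largest common divisor; meaningful when `S` contains a nonzero
element). -/
noncomputable def gcdSet (S : Set ℕ) : ℕ := sSup {d : ℕ | ∀ s ∈ S, d ∣ s}

/-- `S/d = {s/d : s ∈ S}` where `d = gcdSet S`. -/
noncomputable def divGcd (S : Set ℕ) : Set ℕ := (fun s => s / gcdSet S) '' S

/-- The residue of an arbitrary submonoid `S` of ℕ (with a nonzero element):
`res(S) = res(S/d)` where `d` is the gcd of the elements of `S`. -/
noncomputable def resExt (S : Set ℕ) : ℕ := res (divGcd S)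


structure Par (x y z p q v1 v2 u w : ℤ) : Prop where
  hp : 1 ≤ p
  hq : 1 ≤ q
  hv1 : 0 ≤ v1
  hv2 : 0 ≤ v2
  hv : 1 ≤ v1 + v2
  hu : p ≤ u
  hw : q ≤ w
  hx : x = (v1 + v2) * w + q * v1
  hy : y = q * (p + u) + p * w
  hz : z = (v1 + v2) * (p + u) - p * v1
  hg : ∃ α β γ : ℤ, α * x + β * y + γ * z = 1

/-- membership in the semigroup -/
def Mem3 (x y z n : ℤ) : Prop :=
  ∃ s t r : ℤ, 0 ≤ s ∧ 0 ≤ t ∧ 0 ≤ r ∧ n = s * x + t * y + r * z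

theorem Mem3.add {x y z n m : ℤ} (h : Mem3 x y z n) (h' : Mem3 x y z m) :
    Mem3 x y z (n + m) := by
  obtain ⟨s, t, r, hs, ht, hr, e⟩ := h
  obtain ⟨s', t', r', hs', ht', hr', e'⟩ := h'
  exact ⟨s + s', t + t', r + r', by omega, by omega, by omega, by rw [e, e']; ring⟩

section
variable {x y z p q v1 v2 u w : ℤ}

theorem Par.xpos (P : Par x y z p q v1 v2 u w) : 0 < x := by
  obtain ⟨hp, hq, hv1, hv2, hv, hu, hw, hx, hy, hz, hg⟩ := P
  have h1 : 0 < (v1 + v2) * w := by apply mul_pos <;> omega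
  have h2 : 0 ≤ q * v1 := by apply mul_nonneg <;> omega
  omega

theorem Par.ypos (P : Par x y z p q v1 v2 u w) : 0 < y := by
  obtain ⟨hp, hq, hv1, hv2, hv, hu, hw, hx, hy, hz, hg⟩ := P
  have h1 : 0 < q * (p + u) := by apply mul_pos <;> omega
  have h2 : 0 ≤ p * w := by apply mul_nonneg <;> omega
  omega

theorem Par.zpos (P : Par x y z p q v1 v2 u w) : 0 < z := by
  obtain ⟨hp, hq, hv1, hv2, hv, hu, hw, hx, hy, hz, hg⟩ := P
  have h1 : 0 < (v1 + v2) * u := by apply mul_pos <;> omega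
  have h2 : 0 ≤ v2 * p := by apply mul_nonneg <;> omega
  nlinarith

theorem Par.lattice (P : Par x y z p q v1 v2 u w) {s t r : ℤ}
    (h : s * x + t * y + r * z = 0) :
    ∃ m n : ℤ, s = (m + n) * p + n * u ∧ t = -((m + n) * v1 + m * v2) ∧ r = m * q - n * w := by
  have xp := P.xpos
  obtain ⟨hp, hq, hv1, hv2, hv, hu, hw, hx, hy, hz, α, β, γ, hg⟩ := P
  -- relations
  have r1 : (v1 + v2) * y = p * x + q * z := by subst hx hy hz; ring
  have r2 : (p + u) * x = v1 * y + w * z := by subst hx hy hz; ring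
  -- n = -(q t + v r)/x
  have d1 : q * t + (v1 + v2) * r =
      x * ((q * t + (v1 + v2) * r) * α + β * (r * p - q * s) + γ * (- t * p - (v1+v2) * s)) := by
    linear_combination (-(q * t + (v1 + v2) * r)) * hg + (β * q + γ * (v1 + v2)) * h
      + (β * r - γ * t) * r1
  have d2 : -w * t + v1 * r =
      x * ((-w * t + v1 * r) * α + β * (w * s + (p + u) * r) + γ * (-v1 * s - (p + u) * t)) := by
    linear_combination (w * t - v1 * r) * hg + (-β * w - γ * (-v1)) * h
      + (-β * r + γ * t) * r2
  set N := ((q * t + (v1 + v2) * r) * α + β * (r * p - q * s) + γ * (- t * p - (v1+v2) * s))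
  set M := ((-w * t + v1 * r) * α + β * (w * s + (p + u) * r) + γ * (-v1 * s - (p + u) * t))
  have x0 : x ≠ 0 := by omega
  have et : t = -((M + -N) * v1 + M * v2) := by
    apply mul_left_cancel₀ x0
    linear_combination (-(v1+v2)) * d2 + v1 * d1 + t * hx
  have er : r = M * q - (-N) * w := by
    apply mul_left_cancel₀ x0
    linear_combination q * d2 + w * d1 + r * hx
  refine ⟨M, -N, ?_, et, er⟩
  apply mul_left_cancel₀ x0
  linear_combination h - y * et - z * er + M * r1 + N * r2

theorem Par.f1_not (P : Par x y z p q v1 v2 u w) :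
    ¬ Mem3 x y z (-x + (v1 + v2 - 1) * y + (w - 1) * z) := by
  rintro ⟨s, t, r, hs, ht, hr, e⟩
  obtain ⟨m, n, e1, e2, e3⟩ := P.lattice (s := s + 1) (t := t + 1 - (v1 + v2)) (r := r + 1 - w)
    (by linear_combination -e)
  obtain ⟨hp, hq, hv1, hv2, hv, hu, hw, hx, hy, hz, hg⟩ := P
  have key : 1 ≤ m ∧ 1 ≤ m + n := by
    rcases le_or_gt 1 n with hn | hn
    · have : 1 ≤ m := by
        by_contra hm
        nlinarith [mul_nonneg (by omega : 0 ≤ -m) (by omega : 0 ≤ q),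
          mul_nonneg (by omega : 0 ≤ n - 1) (by omega : 0 ≤ w)]
      omega
    · have : 1 ≤ m + n := by
        by_contra hm
        nlinarith [mul_nonneg (by omega : 0 ≤ -(m + n)) (by omega : 0 ≤ p),
          mul_nonneg (by omega : 0 ≤ -n) (by omega : 0 ≤ u)]
      omega
  nlinarith [mul_nonneg (by omega : 0 ≤ m + n - 1) hv1, mul_nonneg (by omega : 0 ≤ m - 1) hv2]

theorem Par.f2_not (P : Par x y z p q v1 v2 u w) :
    ¬ Mem3 x y z (-x + (v1 - 1) * y + (q + w - 1) * z) := by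
  rintro ⟨s, t, r, hs, ht, hr, e⟩
  obtain ⟨m, n, e1, e2, e3⟩ := P.lattice (s := s + 1) (t := t + 1 - v1) (r := r + 1 - (q + w))
    (by linear_combination -e)
  obtain ⟨hp, hq, hv1, hv2, hv, hu, hw, hx, hy, hz, hg⟩ := P
  have key : 0 ≤ m ∧ 1 ≤ m + n := by
    rcases le_or_gt 1 n with hn | hn
    · have : 0 ≤ m := by
        by_contra hm
        nlinarith [mul_nonneg (by omega : 0 ≤ -m - 1) (by omega : 0 ≤ q),
          mul_nonneg (by omega : 0 ≤ n - 1) (by omega : 0 ≤ w)]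
      omega
    · have : 1 ≤ m + n := by
        by_contra hm
        nlinarith [mul_nonneg (by omega : 0 ≤ -(m + n)) (by omega : 0 ≤ p),
          mul_nonneg (by omega : 0 ≤ -n) (by omega : 0 ≤ u)]
      omega
  nlinarith [mul_nonneg (by omega : 0 ≤ m + n - 1) hv1, mul_nonneg (by omega : 0 ≤ m) hv2]

theorem Par.not_mem (P : Par x y z p q v1 v2 u w) {g : ℤ} (hgm : ¬ Mem3 x y z g) :
    Mem3 x y z ((-x + (v1 + v2 - 1) * y + (w - 1) * z) - g) ∨
    Mem3 x y z ((-x + (v1 - 1) * y + (q + w - 1) * z) - g) := by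
  have xp := P.xpos
  have yp := P.ypos
  have zp := P.zpos
  obtain ⟨hp, hq, hv1, hv2, hv, hu, hw, hx, hy, hz, α, β, γ, hg⟩ := P
  have r1 : (v1 + v2) * y = p * x + q * z := by subst hx hy hz; ring
  have r2 : (p + u) * x = v1 * y + w * z := by subst hx hy hz; ring
  obtain ⟨s, ⟨t, r, ht, hr, e⟩, hmax⟩ := Int.exists_greatest_of_bdd
    (P := fun s : ℤ => ∃ t r : ℤ, 0 ≤ t ∧ 0 ≤ r ∧ g = s * x + t * y + r * z)
    (by
      refine ⟨|g|, ?_⟩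
      rintro s ⟨t, r, ht, hr, e⟩
      by_contra hs
      push Not at hs
      have h1 := abs_nonneg g
      have h2 := le_abs_self g
      nlinarith [mul_nonneg ht yp.le, mul_nonneg hr zp.le,
        mul_nonneg (by omega : 0 ≤ s) (by omega : 0 ≤ x - 1)])
    (by
      refine ⟨g * α - |g * β| * y - |g * γ| * z, g * β + |g * β| * x, g * γ + |g * γ| * x, ?_, ?_, ?_⟩
      · nlinarith [neg_abs_le (g * β), abs_nonneg (g * β)]
      · nlinarith [neg_abs_le (g * γ), abs_nonneg (g * γ)]
      · linear_combination -g * hg)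
  have hs : s < 0 := by
    by_contra hs
    exact hgm ⟨s, t, r, by omega, ht, hr, e⟩
  have c1 : t < v1 + v2 := by
    by_contra hc
    have := hmax (s + p) ⟨t - (v1 + v2), r + q, by omega, by omega, by linear_combination e + r1⟩
    omega
  have c2 : r < q + w := by
    by_contra hc
    have := hmax (s + u) ⟨t + v2, r - (q + w), by omega, by omega,
      by linear_combination e - r2 - r1⟩
    omega
  have c3 : ¬ (v1 ≤ t ∧ w ≤ r) := by
    rintro ⟨h1, h2⟩
    have := hmax (s + (p + u)) ⟨t - v1, r - w, by omega, by omega, by linear_combination e - r2⟩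
    omega
  by_cases h : v1 ≤ t
  · left
    exact ⟨-1 - s, v1 + v2 - 1 - t, w - 1 - r, by omega, by omega, by omega,
      by rw [e]; ring⟩
  · right
    exact ⟨-1 - s, v1 - 1 - t, q + w - 1 - r, by omega, by omega, by omega,
      by rw [e]; ring⟩

theorem Par.box (P : Par x y z p q v1 v2 u w) {s t r s' t' r' : ℤ}
    (hs' : 0 ≤ s') (ht' : 0 ≤ t') (hr' : 0 ≤ r')
    (hs : s < p) (ht1 : t < v1) (ht2 : t < v2) (hr : r < q)
    (e : s * x + t * y + r * z = s' * x + t' * y + r' * z) : s = s' ∧ t = t' ∧ r = r' := by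
  obtain ⟨m, n, e1, e2, e3⟩ := P.lattice (s := s' - s) (t := t' - t) (r := r' - r)
    (by linear_combination -e)
  obtain ⟨hp, hq, hv1, hv2, hv, hu, hw, hx, hy, hz, hg⟩ := P
  have key : (m = 0 ∧ n = 0) ∨ (1 ≤ m ∧ 1 ≤ m + n) := by
    rcases lt_trichotomy n 0 with hn | hn | hn
    · right
      have : 0 ≤ m + 2 * n := by
        by_contra hm
        nlinarith [mul_nonneg (by omega : 0 ≤ -(m + 2 * n) - 1) (by omega : 0 ≤ p),
          mul_nonneg (by omega : 0 ≤ -n) (by omega : 0 ≤ u - p)]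
      omega
    · subst hn
      have : 0 ≤ m := by
        by_contra hm
        nlinarith [mul_nonneg (by omega : 0 ≤ -m - 1) (by omega : 0 ≤ p)]
      omega
    · right
      have : n ≤ m := by
        by_contra hm
        nlinarith [mul_nonneg (by omega : 0 ≤ n - m - 1) (by omega : 0 ≤ q),
          mul_nonneg (by omega : 0 ≤ n) (by omega : 0 ≤ w - q)]
      omega
  rcases key with ⟨rfl, rfl⟩ | ⟨h1, h2⟩
  · refine ⟨by linarith, by linarith, by linarith⟩
  · exfalso
    nlinarith [mul_nonneg (by omega : 0 ≤ m + n - 1) hv1, mul_nonneg (by omega : 0 ≤ m - 1) hv2]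

theorem Par.K1 (P : Par x y z p q v1 v2 u w) {s t r s' t' r' : ℤ}
    (hs' : 0 ≤ s') (ht' : 0 ≤ t') (hr' : 0 ≤ r')
    (hs : s < p) (ht1 : t < v1) (hr : r < q)
    (e : s * x + t * y + r * z + (p * x - v1 * y) = s' * x + t' * y + r' * z) : False := by
  obtain ⟨m, n, e1, e2, e3⟩ := P.lattice (s := s' - s - p) (t := t' - t + v1) (r := r' - r)
    (by linear_combination -e)
  obtain ⟨hp, hq, hv1, hv2, hv, hu, hw, hx, hy, hz, hg⟩ := P
  have key : 0 ≤ m ∧ 0 ≤ m + n := by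
    rcases lt_trichotomy n 0 with hn | hn | hn
    · have : -1 ≤ m + 2 * n := by
        by_contra hm
        nlinarith [mul_nonneg (by omega : 0 ≤ -(m + 2 * n) - 2) (by omega : 0 ≤ p),
          mul_nonneg (by omega : 0 ≤ -n) (by omega : 0 ≤ u - p)]
      omega
    · subst hn
      have : 0 ≤ m := by
        by_contra hm
        nlinarith [mul_nonneg (by omega : 0 ≤ -m - 1) (by omega : 0 ≤ q)]
      omega
    · have : n ≤ m := by
        by_contra hm
        nlinarith [mul_nonneg (by omega : 0 ≤ n - m - 1) (by omega : 0 ≤ q),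
          mul_nonneg (by omega : 0 ≤ n) (by omega : 0 ≤ w - q)]
      omega
  obtain ⟨h1, h2⟩ := key
  nlinarith [mul_nonneg h2 hv1, mul_nonneg h1 hv2]

theorem Par.K2 (P : Par x y z p q v1 v2 u w) {s t r s' t' r' : ℤ}
    (hs : 0 ≤ s) (ht : 0 ≤ t) (hr : 0 ≤ r)
    (hs' : s' < p) (ht2 : t' < v2) (hr' : r' < q)
    (e : s * x + t * y + r * z + (p * x - v1 * y) = s' * x + t' * y + r' * z) : False := by
  obtain ⟨m, n, e1, e2, e3⟩ := P.lattice (s := s' - s - p) (t := t' - t + v1) (r := r' - r)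
    (by linear_combination -e)
  obtain ⟨hp, hq, hv1, hv2, hv, hu, hw, hx, hy, hz, hg⟩ := P
  have key : m ≤ -1 ∧ m + n ≤ -1 := by
    rcases le_or_gt 0 n with hn | hn
    · have : m + 2 * n ≤ -1 := by
        by_contra hm
        nlinarith [mul_nonneg (by omega : 0 ≤ m + 2 * n) (by omega : 0 ≤ p),
          mul_nonneg (by omega : 0 ≤ n) (by omega : 0 ≤ u - p)]
      omega
    · have : m ≤ n := by
        by_contra hm
        nlinarith [mul_nonneg (by omega : 0 ≤ m - n - 1) (by omega : 0 ≤ q),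
          mul_nonneg (by omega : 0 ≤ -n) (by omega : 0 ≤ w - q)]
      omega
  obtain ⟨h1, h2⟩ := key
  nlinarith [mul_nonneg (by omega : 0 ≤ -1 - (m + n)) hv1, mul_nonneg (by omega : 0 ≤ -1 - m) hv2]

end

/-- the semigroup generated by three numbers, explicitly -/
def gen3 (x y z : ℕ) : Set ℕ := {n | ∃ s t r : ℕ, n = s * x + t * y + r * z}

theorem memZ_gen3 (x y z : ℕ) (n : ℤ) : memZ (gen3 x y z) n ↔ Mem3 x y z n := by
  constructor
  · rintro ⟨k, ⟨s, t, r, rfl⟩, rfl⟩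
    exact ⟨s, t, r, by positivity, by positivity, by positivity, by push_cast; ring⟩
  · rintro ⟨s, t, r, hs, ht, hr, rfl⟩
    lift s to ℕ using hs
    lift t to ℕ using ht
    lift r to ℕ using hr
    exact ⟨_, ⟨s, t, r, rfl⟩, by push_cast; ring⟩

theorem Mem3.of_gen3 {x y z h : ℕ} (hh : h ∈ gen3 x y z) : Mem3 x y z (h : ℤ) :=
  (memZ_gen3 x y z h).1 ⟨h, hh, rfl⟩

theorem Mem3.zero (x y z : ℤ) : Mem3 x y z 0 := ⟨0, 0, 0, by simp⟩

theorem can_iff {x y z : ℕ} {p q v1 v2 u w : ℤ} (P : Par x y z p q v1 v2 u w) (k : ℤ) :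
    k ∈ canIdeal (gen3 x y z) ↔
      (Mem3 x y z (k + (-x + (v1 + v2 - 1) * y + (w - 1) * z)) ∨
       Mem3 x y z (k + (-x + (v1 - 1) * y + (q + w - 1) * z))) := by
  have F1 := P.f1_not
  have F2 := P.f2_not
  have N := fun g => P.not_mem (g := g)
  set f1 : ℤ := (-x + (v1 + v2 - 1) * y + (w - 1) * z)
  set f2 : ℤ := (-x + (v1 - 1) * y + (q + w - 1) * z)
  have nonneg : ∀ n, Mem3 x y z n → 0 ≤ n := by
    rintro n ⟨s, t, r, hs, ht, hr, rfl⟩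
    positivity
  constructor
  · rintro ⟨f, ⟨hf, -⟩, h, hh, rfl⟩
    rw [memZ_gen3] at hf
    rcases N f hf with h1 | h1
    · left
      have := h1.add (Mem3.of_gen3 hh)
      convert this using 1
      ring
    · right
      have := h1.add (Mem3.of_gen3 hh)
      convert this using 1
      ring
  · intro hk
    have ex : ∃ f, ¬ Mem3 x y z f ∧ Mem3 x y z (k + f) := by
      rcases hk with hk | hk
      · exact ⟨f1, F1, hk⟩
      · exact ⟨f2, F2, hk⟩
    obtain ⟨f, ⟨hf1, hf2⟩, hmax⟩ := Int.exists_greatest_of_bdd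
      (P := fun f => ¬ Mem3 x y z f ∧ Mem3 x y z (k + f))
      ⟨max f1 f2, by
        rintro f ⟨hf, -⟩
        rcases N f hf with h | h
        · have := nonneg _ h
          omega
        · have := nonneg _ h
          omega⟩ ex
    have hf2' := (memZ_gen3 x y z _).2 hf2
    obtain ⟨h, hh, eh⟩ := hf2'
    refine ⟨f, ⟨by rwa [memZ_gen3], ?_⟩, h, hh, by omega⟩
    intro m hm hm0
    rw [memZ_gen3]
    by_contra hc
    have := hmax (f + m) ⟨hc, by rw [← add_assoc]; exact hf2.add (Mem3.of_gen3 hm)⟩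
    omega

theorem trace_iff {x y z : ℕ} {p q v1 v2 u w : ℤ} (P : Par x y z p q v1 v2 u w) (k : ℤ) :
    k ∈ trace (gen3 x y z) ↔
      (Mem3 x y z (k - p * x) ∨ Mem3 x y z (k - min v1 v2 * y) ∨ Mem3 x y z (k - q * z)) := by
  have C := can_iff P
  have r1 : (v1 + v2) * y = p * x + q * z := by rw [P.hx, P.hy, P.hz]; ring
  have A : ∀ k, k ∈ antiCanIdeal (gen3 x y z) ↔
      (Mem3 x y z (k - (-x + (v1 + v2 - 1) * y + (w - 1) * z)) ∧
       Mem3 x y z (k - (-x + (v1 - 1) * y + (q + w - 1) * z))) := by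
    intro k
    simp only [antiCanIdeal, Set.mem_setOf_eq, C, memZ_gen3]
    constructor
    · intro h
      constructor
      · apply h
        left
        convert Mem3.zero x y z using 1
        ring
      · apply h
        right
        convert Mem3.zero x y z using 1
        ring
    · rintro ⟨h1, h2⟩ g (hg | hg)
      · convert h1.add hg using 1
        ring
      · convert h2.add hg using 1
        ring
  -- the trace in terms of K
  have T : k ∈ trace (gen3 x y z) ↔ ∃ h, Mem3 x y z h ∧ Mem3 x y z (h + (p * x - v1 * y)) ∧
      (Mem3 x y z (k - h) ∨ Mem3 x y z (k - (h + (p * x - v1 * y)))) := by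
    simp only [trace, Set.mem_setOf_eq, C, A]
    constructor
    · rintro ⟨g, hg, c, ⟨h1, h2⟩, rfl⟩
      refine ⟨_, h1, ?_, ?_⟩
      · convert h2 using 1
        linear_combination -r1
      · rcases hg with hg | hg
        · left
          convert hg using 1
          ring
        · right
          convert hg using 1
          linear_combination r1
    · rintro ⟨h, h1, h2, h3⟩
      refine ⟨k - (h + (-x + (v1 + v2 - 1) * y + (w - 1) * z)), ?_,
        h + (-x + (v1 + v2 - 1) * y + (w - 1) * z), ⟨?_, ?_⟩, by ring⟩
      · rcases h3 with h3 | h3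
        · left
          convert h3 using 1
          ring
        · right
          convert h3 using 1
          linear_combination -r1
      · convert h1 using 1
        ring
      · convert h2 using 1
        linear_combination r1
  rw [T]
  have hp := P.hp
  have hq := P.hq
  have hv1 := P.hv1
  have hv2 := P.hv2
  constructor
  · rintro ⟨h, ⟨s, t, r, hs, ht, hr, e⟩, ⟨s', t', r', hs', ht', hr', e'⟩, hk⟩
    have fin : ∀ s t r g : ℤ, 0 ≤ s → 0 ≤ t → 0 ≤ r → (p ≤ s ∨ min v1 v2 ≤ t ∨ q ≤ r) →
        g = s * x + t * y + r * z → Mem3 x y z (k - g) →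
        (Mem3 x y z (k - p * x) ∨ Mem3 x y z (k - min v1 v2 * y) ∨ Mem3 x y z (k - q * z)) := by
      rintro s t r g hs ht hr (h | h | h) rfl hg
      · left
        convert hg.add ⟨s - p, t, r, by omega, ht, hr, rfl⟩ using 1
        ring
      · right; left
        convert hg.add ⟨s, t - min v1 v2, r, hs, by omega, hr, rfl⟩ using 1
        ring
      · right; right
        convert hg.add ⟨s, t, r - q, hs, ht, by omega, rfl⟩ using 1
        ring
    rcases hk with hk | hk
    · refine fin s t r h hs ht hr ?_ e hk
      by_contra hc
      push Not at hc
      exact P.K1 hs' ht' hr' hc.1 (lt_min_iff.1 hc.2.1).1 hc.2.2 (by rw [← e]; exact e')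
    · refine fin s' t' r' _ hs' ht' hr' ?_ e' hk
      by_contra hc
      push Not at hc
      exact P.K2 hs ht hr hc.1 (lt_min_iff.1 hc.2.1).2 hc.2.2 (by rw [← e]; exact e')
  · have Y1 : Mem3 x y z (v1 * y) := ⟨0, v1, 0, by omega, by omega, by omega, by ring⟩
    have X1 : Mem3 x y z (v1 * y + (p * x - v1 * y)) :=
      ⟨p, 0, 0, by omega, by omega, by omega, by ring⟩
    have Z1 : Mem3 x y z (q * z) := ⟨0, 0, q, by omega, by omega, by omega, by ring⟩
    have Y2 : Mem3 x y z (q * z + (p * x - v1 * y)) :=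
      ⟨0, v2, 0, by omega, by omega, by omega, by linear_combination -r1⟩
    rintro (h | h | h)
    · refine ⟨_, Y1, X1, Or.inr ?_⟩
      convert h using 1
      ring
    · rcases min_choice v1 v2 with hm | hm <;> rw [hm] at h
      · exact ⟨_, Y1, X1, Or.inl h⟩
      · refine ⟨_, Z1, Y2, Or.inr ?_⟩
        convert h using 1
        linear_combination r1
    · exact ⟨_, Z1, Y2, Or.inl h⟩

theorem res_gen3 {x y z p q v1 v2 u w : ℕ} (P : Par x y z p q v1 v2 u w) :
    res (gen3 x y z) = p * (min v1 v2 * q) := by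
  have key : {h : ℕ | h ∈ gen3 x y z ∧ (h : ℤ) ∉ trace (gen3 x y z)} =
      (fun c : ℕ × ℕ × ℕ => c.1 * x + c.2.1 * y + c.2.2 * z) ''
        ((Finset.range p ×ˢ Finset.range (min v1 v2) ×ˢ Finset.range q : Finset _) :
          Set (ℕ × ℕ × ℕ)) := by
    ext h
    simp only [Set.mem_setOf_eq, trace_iff P, Set.mem_image, Finset.coe_product,
      Set.mem_prod, Finset.coe_range, Set.mem_Iio, Prod.exists]
    constructor
    · rintro ⟨⟨s, t, r, rfl⟩, hn⟩
      push Not at hn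
      obtain ⟨n1, n2, n3⟩ := hn
      refine ⟨s, t, r, ⟨?_, ?_, ?_⟩, rfl⟩
      · by_contra hc
        exact n1 ⟨s - p, t, r, by omega, by omega, by omega, by push_cast; ring⟩
      · by_contra hc
        exact n2 ⟨s, t - (min v1 v2 : ℕ), r, by omega, by omega, by omega, by push_cast; ring⟩
      · by_contra hc
        exact n3 ⟨s, t, r - q, by omega, by omega, by omega, by push_cast; ring⟩
    · rintro ⟨s, t, r, ⟨hs, ht, hr⟩, rfl⟩
      refine ⟨⟨s, t, r, rfl⟩, ?_⟩
      push_cast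
      rintro (⟨s', t', r', hs', ht', hr', e⟩ | ⟨s', t', r', hs', ht', hr', e⟩ |
        ⟨s', t', r', hs', ht', hr', e⟩)
      · have := P.box (s := s) (t := t) (r := r) (s' := s' + p) (t' := t') (r' := r')
          (by omega) (by omega) (by omega) (by omega) (by omega) (by omega) (by omega)
          (by linear_combination e)
        omega
      · have := P.box (s := s) (t := t) (r := r) (s' := s') (t' := t' + min (v1 : ℤ) v2) (r' := r')
          (by omega) (by omega) (by omega) (by omega) (by omega) (by omega) (by omega)
          (by linear_combination e)
        omega
      · have := P.box (s := s) (t := t) (r := r) (s' := s') (t' := t') (r' := r' + q)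
          (by omega) (by omega) (by omega) (by omega) (by omega) (by omega) (by omega)
          (by linear_combination e)
        omega
  rw [res, key, Set.ncard_image_of_injOn, Set.ncard_coe_finset]
  · simp
  · rintro ⟨s, t, r⟩ h1 ⟨s', t', r'⟩ h2 e
    simp only [Finset.coe_product, Set.mem_prod, Finset.coe_range, Set.mem_Iio] at h1 h2 e
    have := P.box (s := s) (t := t) (r := r) (s' := s') (t' := t') (r' := r')
          (by omega) (by omega) (by omega) (by omega) (by omega) (by omega) (by omega)
          (by exact_mod_cast e)
    simp only [Prod.mk.injEq]
    omega

theorem genBy_eq (x y z : ℕ) : genBy {x, y, z} = gen3 x y z := by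
  ext n
  simp only [genBy, SetLike.mem_coe]
  constructor
  · intro h
    induction h using AddSubmonoid.closure_induction with
    | mem n hn =>
      simp only [Set.mem_insert_iff, Set.mem_singleton_iff] at hn
      rcases hn with rfl | rfl | rfl
      · exact ⟨1, 0, 0, by ring⟩
      · exact ⟨0, 1, 0, by ring⟩
      · exact ⟨0, 0, 1, by ring⟩
    | zero => exact ⟨0, 0, 0, by ring⟩
    | add a b _ _ ha hb =>
      obtain ⟨s, t, r, rfl⟩ := ha
      obtain ⟨s', t', r', rfl⟩ := hb
      exact ⟨s + s', t + t', r + r', by ring⟩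
  · rintro ⟨s, t, r, rfl⟩
    have hx : x ∈ AddSubmonoid.closure ({x, y, z} : Set ℕ) := AddSubmonoid.subset_closure (by simp)
    have hy : y ∈ AddSubmonoid.closure ({x, y, z} : Set ℕ) := AddSubmonoid.subset_closure (by simp)
    have hz : z ∈ AddSubmonoid.closure ({x, y, z} : Set ℕ) := AddSubmonoid.subset_closure (by simp)
    have := add_mem (add_mem (nsmul_mem hx s) (nsmul_mem hy t)) (nsmul_mem hz r)
    simpa using this

theorem divGcd_gen3 (d x y z : ℕ) (hd : 0 < d)
    (hg : ∃ α β γ : ℤ, α * x + β * y + γ * z = 1) :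
    divGcd (gen3 (d * x) (d * y) (d * z)) = gen3 x y z := by
  have hG : gcdSet (gen3 (d * x) (d * y) (d * z)) = d := by
    apply IsGreatest.csSup_eq
    constructor
    · rintro n ⟨s, t, r, rfl⟩
      exact ⟨s * x + t * y + r * z, by ring⟩
    · intro e he
      obtain ⟨α, β, γ, hg⟩ := hg
      have h1 : e ∣ d * x := he _ ⟨1, 0, 0, by ring⟩
      have h2 : e ∣ d * y := he _ ⟨0, 1, 0, by ring⟩
      have h3 : e ∣ d * z := he _ ⟨0, 0, 1, by ring⟩
      have h1' : (e : ℤ) ∣ d * x := by exact_mod_cast h1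
      have h2' : (e : ℤ) ∣ d * y := by exact_mod_cast h2
      have h3' : (e : ℤ) ∣ d * z := by exact_mod_cast h3
      have : (e : ℤ) ∣ d := by
        have := dvd_add (dvd_add (h1'.mul_left α) (h2'.mul_left β)) (h3'.mul_left γ)
        have e2 : α * (d * x) + β * (d * y) + γ * (d * z) = (d : ℤ) := by
          linear_combination (d : ℤ) * hg
        rwa [e2] at this
      exact Nat.le_of_dvd hd (by exact_mod_cast this)
  ext n
  simp only [divGcd, hG, Set.mem_image]
  constructor
  · rintro ⟨_, ⟨s, t, r, rfl⟩, rfl⟩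
    refine ⟨s, t, r, ?_⟩
    rw [show s * (d * x) + t * (d * y) + r * (d * z) = d * (s * x + t * y + r * z) by ring]
    exact Nat.mul_div_cancel_left _ hd
  · rintro ⟨s, t, r, rfl⟩
    refine ⟨_, ⟨s, t, r, rfl⟩, ?_⟩
    rw [show s * (d * x) + t * (d * y) + r * (d * z) = d * (s * x + t * y + r * z) by ring]
    exact Nat.mul_div_cancel_left _ hd

theorem res_param {J E p q v1 v2 w : ℕ} (hp : 1 ≤ p) (hq : 1 ≤ q) (hv : v1 + v2 = p + q)
    (hJ : J = v1 * q + w * (p + q)) (hw : q ≤ w) (hu : 2 * p ≤ E + v1 + w)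
    (hg : ∃ α β γ : ℤ, α * J + β * (E * q : ℕ) + γ * (E * (p + q) : ℕ) = 1) :
    res (gen3 J (J + E * q) (J + E * (p + q))) = p * (min v1 v2 * q) := by
  obtain ⟨u, hu'⟩ : ∃ u, E + v1 + w = p + u := ⟨E + v1 + w - p, by omega⟩
  have hu2 : (u : ℤ) = E + v1 + w - p := by omega
  have hv2 : (v2 : ℤ) = p + q - v1 := by omega
  apply res_gen3 (u := u) (w := w)
  refine ⟨by omega, by omega, by omega, by omega, by omega, by omega, by omega, ?_, ?_, ?_, ?_⟩
  · rw [hJ]; push_cast; rw [hv2]; ring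
  · rw [hJ]; push_cast; rw [hu2]; ring
  · rw [hJ]; push_cast; rw [hu2, hv2]; ring
  · obtain ⟨α, β, γ, h⟩ := hg
    refine ⟨α - β - γ, β, γ, ?_⟩
    push_cast at h ⊢
    linear_combination h

theorem bezout3 (j a b : ℕ) (hj : 0 < j) : ∃ d j' a' b' : ℕ, 0 < d ∧ j = d * j' ∧ a = d * a' ∧ b = d * b' ∧
    ∃ α β γ : ℤ, α * j' + β * a' + γ * b' = 1 := by
  have hd : 0 < Nat.gcd j (Nat.gcd a b) := Nat.gcd_pos_of_pos_left _ hj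
  obtain ⟨j', hj'⟩ := Nat.gcd_dvd_left j (Nat.gcd a b)
  obtain ⟨a', ha'⟩ := (Nat.gcd_dvd_right j (Nat.gcd a b)).trans (Nat.gcd_dvd_left a b)
  obtain ⟨b', hb'⟩ := (Nat.gcd_dvd_right j (Nat.gcd a b)).trans (Nat.gcd_dvd_right a b)
  refine ⟨_, j', a', b', hd, hj', ha', hb', ?_⟩
  have e1 := Nat.gcd_eq_gcd_ab j (Nat.gcd a b)
  have e2 := Nat.gcd_eq_gcd_ab a b
  generalize Nat.gcdA j (Nat.gcd a b) = A at *
  generalize Nat.gcdB j (Nat.gcd a b) = B at *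
  generalize Nat.gcdA a b = A' at *
  generalize Nat.gcdB a b = B' at *
  rw [e2] at e1
  generalize Nat.gcd j (Nat.gcd a b) = d at *
  refine ⟨A, B * A', B * B', ?_⟩
  have hd0 : (d : ℤ) ≠ 0 := by positivity
  apply mul_left_cancel₀ hd0
  have hj2 : (j : ℤ) = d * j' := by exact_mod_cast hj'
  have ha2 : (a : ℤ) = d * a' := by exact_mod_cast ha'
  have hb2 : (b : ℤ) = d * b' := by exact_mod_cast hb'
  linear_combination -e1 - A * hj2 - B * A' * ha2 - B * B' * hb2

/-- for `0 < a < b`, `D = gcd(a,b)`, `k = max{b((b-a)/D - 1), ab/D}`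
and `H_j = ⟨j, j+a, j+b⟩`, one has `res(H_j) = res(H_{j+b})` for all `j > 2k`. -/
theorem stmt_13 (a b : ℕ) (ha : 0 < a) (hab : a < b)
    (D k : ℕ) (hD : D = Nat.gcd a b)
    (hk : k = max (b * ((b - a) / D - 1)) (a * b / D)) :
    ∀ j : ℕ, 1 ≤ j → 2 * k < j →
      resExt (genBy {j, j + a, j + b}) =
        resExt (genBy {j + b, j + b + a, j + b + b}) := by
  intro j hj hjk
  obtain ⟨d, J, a', b', hd, rfl, rfl, rfl, α, β, γ, hg⟩ := bezout3 j a b hj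
  -- gcd of a' and b'
  have ha' : 0 < a' := Nat.pos_of_mul_pos_left ha
  have hab' : a' < b' := lt_of_mul_lt_mul_left hab (Nat.zero_le d)
  obtain ⟨E, q, c, hE, hcop, rfl, rfl⟩ : ∃ E q c : ℕ, 0 < E ∧ Nat.Coprime q c ∧ a' = E * q ∧ b' = E * c := by
    obtain ⟨E, q, c, h1, h2, h3, h4⟩ := Nat.exists_coprime' (m := a') (n := b')
      (Nat.gcd_pos_of_pos_left _ ha')
    exact ⟨E, q, c, h1, h2, by rw [h3, mul_comm], by rw [h4, mul_comm]⟩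
  have hqc : q < c := lt_of_mul_lt_mul_left hab' (Nat.zero_le E)
  obtain ⟨p, rfl⟩ : ∃ p, c = p + q := ⟨c - q, by omega⟩
  have hp : 1 ≤ p := by omega
  have hq : 1 ≤ q := Nat.pos_of_mul_pos_left ha'
  have hD' : D = d * E := by
    rw [hD, Nat.gcd_mul_left, Nat.gcd_mul_left, hcop, mul_one]
  have hDpos : 0 < d * E := Nat.mul_pos hd hE
  have k1 : d * (E * (p + q)) * (p - 1) ≤ k := by
    have : (d * (E * (p + q)) - d * (E * q)) / D = p := by
      rw [hD', show d * (E * (p + q)) = d * (E * q) + d * E * p by ring, Nat.add_sub_cancel_left,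
        Nat.mul_div_cancel_left _ hDpos]
    rw [this] at hk
    rw [hk]
    exact le_max_left _ _
  have k2 : d * (E * (p + q)) * q ≤ k := by
    have : d * (E * q) * (d * (E * (p + q))) / D = d * (E * (p + q)) * q := by
      rw [hD', show d * (E * q) * (d * (E * (p + q))) = d * E * (d * (E * (p + q)) * q) by ring,
        Nat.mul_div_cancel_left _ hDpos]
    rw [this] at hk
    rw [hk]
    exact le_max_right _ _
  have j1 : 2 * (E * (p + q) * (p - 1)) < J := by
    apply lt_of_mul_lt_mul_left _ (Nat.zero_le d)
    calc d * (2 * (E * (p + q) * (p - 1))) = 2 * (d * (E * (p + q)) * (p - 1)) := by ring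
      _ < d * J := by omega
  have j2 : 2 * (E * (p + q) * q) < J := by
    apply lt_of_mul_lt_mul_left _ (Nat.zero_le d)
    calc d * (2 * (E * (p + q) * q)) = 2 * (d * (E * (p + q)) * q) := by ring
      _ < d * J := by omega
  -- choose v1
  obtain ⟨v1, wz, hv1, hw⟩ : ∃ (v1 : ℕ) (wz : ℤ), v1 < p + q ∧ (J : ℤ) = v1 * q + wz * (p + q) := by
    have e := Nat.gcd_eq_gcd_ab q (p + q)
    rw [hcop] at e
    generalize Nat.gcdA q (p + q) = A at e
    generalize Nat.gcdB q (p + q) = B at e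
    have hpos : (0 : ℤ) < (p + q : ℕ) := by omega
    have n1 := Int.emod_nonneg (J * A) hpos.ne'
    have n2 := Int.emod_lt_of_pos (J * A) hpos
    have n3 := Int.emod_add_mul_ediv (J * A) (p + q : ℕ)
    refine ⟨((J * A) % (p + q : ℕ)).toNat, J * B + q * ((J * A) / (p + q : ℕ)), by omega, ?_⟩
    rw [Int.toNat_of_nonneg n1]
    push_cast at *
    linear_combination (J : ℤ) * e - q * n3
  have hwq : (q : ℤ) ≤ wz := by
    by_contra hc
    have c1 : wz ≤ q - 1 := by omega
    zify at j2 hv1 hE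
    have c2 : (0:ℤ) ≤ (E - 1) * ((p + q) * q) := by
      apply mul_nonneg <;> [omega; positivity]
    nlinarith [mul_nonneg (by omega : (0:ℤ) ≤ q - 1 - wz) (by positivity : (0:ℤ) ≤ p + q),
      mul_nonneg (by omega : (0:ℤ) ≤ p + q - v1) (by positivity : (0:ℤ) ≤ q)]
  lift wz to ℕ using by omega
  have hu : 2 * p ≤ E + v1 + wz := by
    by_contra hc
    obtain ⟨p', rfl⟩ : ∃ p', p = p' + 1 := ⟨p - 1, by omega⟩
    rw [Nat.add_sub_cancel] at j1
    have c1 : v1 + wz ≤ 2 * E * p' := by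
      obtain ⟨E', rfl⟩ : ∃ E', E = E' + 1 := ⟨E - 1, by omega⟩
      nlinarith [Nat.zero_le (E' * p')]
    have c2 := Nat.mul_le_mul_right (p' + 1 + q) c1
    zify at j1 c2
    push_cast at hw
    have c3 : (0 : ℤ) ≤ v1 * (p' + 1) := by positivity
    nlinarith
  obtain ⟨v2, hv2⟩ : ∃ v2, v1 + v2 = p + q := ⟨p + q - v1, by omega⟩
  have hw1 : J = v1 * q + wz * (p + q) := by exact_mod_cast hw
  have main1 := res_param (J := J) (E := E) hp hq hv2 hw1 (by omega) hu ⟨α, β, γ, hg⟩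
  have hg2 : ∃ α β γ : ℤ, α * (J + E * (p + q) : ℕ) + β * (E * q : ℕ) + γ * (E * (p + q) : ℕ) = 1 :=
    ⟨α, β, γ - α, by push_cast at hg ⊢; linear_combination hg⟩
  have main2 := res_param (J := J + E * (p + q)) (E := E) (w := wz + E) hp hq hv2
    (by rw [hw1]; ring) (by omega) (by omega) hg2
  rw [resExt, resExt, genBy_eq, genBy_eq]
  have s1 : gen3 (d * J) (d * J + d * (E * q)) (d * J + d * (E * (p + q))) =
      gen3 (d * J) (d * (J + E * q)) (d * (J + E * (p + q))) := by
    simp only [mul_add]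
  have s2 : gen3 (d * J + d * (E * (p + q))) (d * J + d * (E * (p + q)) + d * (E * q))
        (d * J + d * (E * (p + q)) + d * (E * (p + q))) =
      gen3 (d * (J + E * (p + q))) (d * (J + E * (p + q) + E * q))
        (d * (J + E * (p + q) + E * (p + q))) := by
    simp only [mul_add]
  rw [s1, s2, divGcd_gen3 d _ _ _ hd, divGcd_gen3 d _ _ _ hd, main1, main2]
  · obtain ⟨α, β, γ, h⟩ := hg2
    refine ⟨α - β - γ, β, γ, ?_⟩
    push_cast at h ⊢
    linear_combination h
  · refine ⟨α - β - γ, β, γ, ?_⟩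
    push_cast at hg ⊢
    linear_combination hg
end

section
/- Let 0 < a < b be integers, D = gcd(a,b), and k_{a,b} = max{b·((b−a)/D − 1), a·b/D}. For an integer j ≥ 1 let H_j denote the additive submonoid of ℕ generated by {j, j+a, j+b}. Then for all j > 2k_{a,b}, the integer a(b−a)/D² divides res(H_j), and res(H_j) < 8b³/(27D³). -/
open NumSgp


namespace Stmt14

/-- Data of a three-generated numerical semigroup in Herzog form. -/
structure Dat (H : Set ℕ) (n1 n2 n3 p q r s α γ : ℤ) : Prop where
  hH : ∀ z : ℤ, memZ H z ↔ ∃ A B C : ℤ, 0 ≤ A ∧ 0 ≤ B ∧ 0 ≤ C ∧ z = A * n1 + B * n2 + C * n3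
  h1 : 0 < n1
  h2 : 0 < n2
  h3 : 0 < n3
  hp : 0 < p
  hr : 0 < r
  hs : 0 ≤ s
  hsq : s < q
  hγ : 2 * p ≤ γ
  hα : r ≤ α
  rel1 : q * n2 = r * n1 + p * n3
  rel2 : γ * n3 = α * n1 + s * n2
  lat : ∀ x y z : ℤ, x * n1 + y * n2 + z * n3 = 0 →
    ∃ i k : ℤ, x = i * r + k * α ∧ y = - i * q + k * s ∧ z = i * p - k * γ
  surj : ∃ x y z : ℤ, x * n1 + y * n2 + z * n3 = 1

variable {H : Set ℕ} {n1 n2 n3 p q r s α γ : ℤ}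

/-- from `C`-type inequality with `k ≥ 1` -/
lemma auxC {p γ i k c : ℤ} (hp : 0 < p) (hγ : 2 * p ≤ γ) (hk : 0 ≤ k)
    (h : 0 < c * p + i * p - k * γ) : 2 * k < c + i := by
  have h1 : k * (2 * p) ≤ k * γ := mul_le_mul_of_nonneg_left hγ hk
  by_contra hc
  push Not at hc
  nlinarith

lemma auxA {r α i k c : ℤ} (hr : 0 < r) (hα : r ≤ α) (hk : k ≤ 0)
    (h : 0 < c * r + i * r + k * α) : - k < c + i := by
  have h1 : (-k) * r ≤ (-k) * α := mul_le_mul_of_nonneg_left hα (by omega)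
  by_contra hc
  push Not at hc
  nlinarith

lemma auxB {q s i k c : ℤ} (hs : 0 ≤ s) (hsq : s < q) (hk : 0 ≤ k)
    (h : 0 < c * q - i * q + k * s) : i < c + k := by
  have h1 : k * s ≤ k * q := mul_le_mul_of_nonneg_left hsq.le hk
  by_contra hc
  push Not at hc
  nlinarith

lemma auxB' {q s i k c : ℤ} (hs : 0 ≤ s) (hsq : s < q) (hk : k ≤ 0)
    (h : 0 < c * q - i * q + k * s) : i < c := by
  have h1 : k * s ≤ 0 := mul_nonpos_of_nonpos_of_nonneg hk hs
  by_contra hc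
  push Not at hc
  nlinarith

namespace Dat

/-- Second pseudo-Frobenius number. -/
lemma f2_not (d : Dat H n1 n2 n3 p q r s α γ) :
    ¬ memZ H (-n1 + (q - s - 1) * n2 + (γ - 1) * n3) := by
  rw [d.hH]
  rintro ⟨A, B, C, hA, hB, hC, h⟩
  obtain ⟨i, k, e1, e2, e3⟩ := d.lat (A + 1) (B - (q - s - 1)) (C - (γ - 1)) (by linarith)
  have hp := d.hp; have hr := d.hr; have hs := d.hs; have hsq := d.hsq
  rcases le_or_gt k 0 with hk | hk
  · have a1 := auxA (c := 0) hr d.hα hk (i := i) (by linarith)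
    have a2 := auxB' (c := 1) hs hsq hk (i := i) (by linarith)
    omega
  · have a1 := auxC (c := 0) hp d.hγ (k := k - 1) (by omega) (i := i) (by linarith)
    have a2 := auxB (c := 1) hs hsq (k := k - 1) (by omega) (i := i) (by linarith)
    omega

lemma f1_not (d : Dat H n1 n2 n3 p q r s α γ) :
    ¬ memZ H (-n1 + (q - 1) * n2 + (γ - p - 1) * n3) := by
  rw [d.hH]
  rintro ⟨A, B, C, hA, hB, hC, h⟩
  obtain ⟨i, k, e1, e2, e3⟩ := d.lat (A + 1) (B - (q - 1)) (C - (γ - p - 1)) (by linarith)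
  have hp := d.hp; have hr := d.hr; have hs := d.hs; have hsq := d.hsq
  rcases le_or_gt k 0 with hk | hk
  · have a1 := auxA (c := 0) hr d.hα hk (i := i) (by linarith)
    have a2 := auxB' (c := 1) hs hsq hk (i := i) (by linarith)
    omega
  · have a1 := auxC (c := -1) hp d.hγ (k := k - 1) (by omega) (i := i) (by linarith)
    have a2 := auxB (c := 1) hs hsq (k := k) (by omega) (i := i) (by linarith)
    omega

lemma add (d : Dat H n1 n2 n3 p q r s α γ) {x y : ℤ} (hx : memZ H x) (hy : memZ H y) :
    memZ H (x + y) := by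
  rw [d.hH] at *
  obtain ⟨A, B, C, hA, hB, hC, rfl⟩ := hx
  obtain ⟨A', B', C', hA', hB', hC', rfl⟩ := hy
  exact ⟨A + A', B + B', C + C', by omega, by omega, by omega, by ring⟩

lemma pf_of (d : Dat H n1 n2 n3 p q r s α γ) {f : ℤ} (hf : ¬ memZ H f)
    (g1 : memZ H (f + n1)) (g2 : memZ H (f + n2)) (g3 : memZ H (f + n3)) :
    f ∈ pseudoFrob H := by
  refine ⟨hf, fun m hm hm0 => ?_⟩
  have hm' : memZ H (m : ℤ) := ⟨m, hm, rfl⟩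
  rw [d.hH] at hm'
  obtain ⟨A, B, C, hA, hB, hC, h⟩ := hm'
  rcases lt_or_eq_of_le hA with hA' | rfl
  · have := d.add g1 ((d.hH ((A - 1) * n1 + B * n2 + C * n3)).2
      ⟨A - 1, B, C, by omega, hB, hC, rfl⟩)
    rw [h]; convert this using 1; ring
  rcases lt_or_eq_of_le hB with hB' | rfl
  · have := d.add g2 ((d.hH (0 * n1 + (B - 1) * n2 + C * n3)).2
      ⟨0, B - 1, C, le_rfl, by omega, hC, rfl⟩)
    rw [h]; convert this using 1; ring
  rcases lt_or_eq_of_le hC with hC' | rfl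
  · have := d.add g3 ((d.hH (0 * n1 + 0 * n2 + (C - 1) * n3)).2
      ⟨0, 0, C - 1, le_rfl, le_rfl, by omega, rfl⟩)
    rw [h]; convert this using 1; ring
  · exfalso; apply hm0; exact_mod_cast (by simpa using h : (m : ℤ) = 0)

lemma f2_pf (d : Dat H n1 n2 n3 p q r s α γ) :
    -n1 + (q - s - 1) * n2 + (γ - 1) * n3 ∈ pseudoFrob H := by
  have hp := d.hp; have hr := d.hr; have hs := d.hs; have hsq := d.hsq
  have hγ := d.hγ; have hα := d.hα; have e1 := d.rel1; have e2 := d.rel2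
  refine d.pf_of d.f2_not ?_ ?_ ?_ <;> rw [d.hH]
  · exact ⟨0, q - s - 1, γ - 1, by omega, by omega, by omega, by ring⟩
  · exact ⟨α + r - 1, 0, p - 1, by omega, by omega, by omega, by linarith⟩
  · exact ⟨α - 1, q - 1, 0, by omega, by omega, by omega, by linarith⟩

lemma f1_pf (d : Dat H n1 n2 n3 p q r s α γ) (hs1 : 0 < s) :
    -n1 + (q - 1) * n2 + (γ - p - 1) * n3 ∈ pseudoFrob H := by
  have hp := d.hp; have hr := d.hr; have hs := d.hs; have hsq := d.hsq
  have hγ := d.hγ; have hα := d.hα; have e1 := d.rel1; have e2 := d.rel2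
  refine d.pf_of d.f1_not ?_ ?_ ?_ <;> rw [d.hH]
  · exact ⟨0, q - 1, γ - p - 1, by omega, by omega, by omega, by ring⟩
  · exact ⟨r - 1, 0, γ - 1, by omega, by omega, by omega, by linarith⟩
  · exact ⟨α + r - 1, s - 1, 0, by omega, by omega, by omega, by linarith⟩

/-- Normal form. -/
lemma nf (d : Dat H n1 n2 n3 p q r s α γ) {f : ℤ} (hf : ¬ memZ H f) :
    ∃ x B C : ℤ, x < 0 ∧ 0 ≤ B ∧ 0 ≤ C ∧ B < q ∧ C < γ ∧ (B < q - s ∨ C < γ - p) ∧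
      f = x * n1 + B * n2 + C * n3 := by
  have hp := d.hp; have hr := d.hr; have hs := d.hs; have hsq := d.hsq
  have hγ := d.hγ; have hα := d.hα; have e1 := d.rel1; have e2 := d.rel2
  have h1 := d.h1; have h2 := d.h2; have h3 := d.h3
  let P : ℕ → Prop := fun N => ∃ x B C : ℤ, 0 ≤ B ∧ 0 ≤ C ∧ f = x * n1 + B * n2 + C * n3 ∧
    B * n2 + C * n3 = N
  have hex : ∃ N, P N := by
    obtain ⟨x, y, z, h⟩ := d.surj
    have key : ∀ t : ℤ, 0 ≤ t + |t| * n1 := fun t => by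
      have := neg_abs_le t
      nlinarith [abs_nonneg t]
    have k1 := key (f * y)
    have k2 := key (f * z)
    refine ⟨((f * y + |f * y| * n1) * n2 + (f * z + |f * z| * n1) * n3).toNat,
      f * x - |f * y| * n2 - |f * z| * n3, f * y + |f * y| * n1, f * z + |f * z| * n1, k1, k2, ?_, ?_⟩
    · linear_combination (-f) * h
    · rw [Int.toNat_of_nonneg (by positivity)]
  classical
  obtain ⟨x, B, C, hB, hC, hf', hN⟩ := Nat.find_spec hex
  have hmin : ∀ x' B' C' : ℤ, 0 ≤ B' → 0 ≤ C' → f = x' * n1 + B' * n2 + C' * n3 → x' ≤ x := by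
    intro x' B' C' hB' hC' h'
    have := Nat.find_min' hex (m := (B' * n2 + C' * n3).toNat) ⟨x', B', C', hB', hC', h', by
      rw [Int.toNat_of_nonneg (by positivity)]⟩
    have h4 : ((Nat.find hex : ℕ) : ℤ) ≤ B' * n2 + C' * n3 := by
      rw [← Int.toNat_of_nonneg (show 0 ≤ B' * n2 + C' * n3 by positivity)]
      exact_mod_cast this
    by_contra hc
    push Not at hc
    nlinarith
  refine ⟨x, B, C, ?_, hB, hC, ?_, ?_, ?_, hf'⟩
  · by_contra hx
    exact hf ((d.hH f).2 ⟨x, B, C, by omega, hB, hC, hf'⟩)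
  · by_contra hc
    have := hmin (x + r) (B - q) (C + p) (by omega) (by omega) (by linarith)
    omega
  · by_contra hc
    have := hmin (x + α) (B + s) (C - γ) (by omega) (by omega) (by linarith)
    omega
  · by_contra hc
    have := hmin (x + α + r) (B - (q - s)) (C - (γ - p)) (by omega) (by omega) (by linarith)
    omega

lemma pf_unique (d : Dat H n1 n2 n3 p q r s α γ) {f g : ℤ} (hf : f ∈ pseudoFrob H)
    (hg : ¬ memZ H g) (h : memZ H (g - f)) : f = g := by
  obtain ⟨m, hm, e⟩ := h
  by_contra hne
  have := hf.2 m hm (by rintro rfl; apply hne; push_cast at e; omega)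
  rw [e] at this
  exact hg (by simpa using this)

lemma pf_cases (d : Dat H n1 n2 n3 p q r s α γ) {f : ℤ} (hf : f ∈ pseudoFrob H) :
    f = -n1 + (q - s - 1) * n2 + (γ - 1) * n3 ∨
    (0 < s ∧ f = -n1 + (q - 1) * n2 + (γ - p - 1) * n3) := by
  obtain ⟨x, B, C, hx, hB, hC, hBq, hCγ, hor, e⟩ := d.nf hf.1
  by_cases hb : B < q - s
  · left
    apply d.pf_unique hf d.f2_not
    rw [d.hH]
    exact ⟨-1 - x, q - s - 1 - B, γ - 1 - C, by omega, by omega, by omega, by rw [e]; ring⟩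
  · right
    refine ⟨by omega, ?_⟩
    apply d.pf_unique hf d.f1_not
    rw [d.hH]
    exact ⟨-1 - x, q - 1 - B, γ - p - 1 - C, by omega, by omega, by omega, by rw [e]; ring⟩

lemma trace_zero (d : Dat H n1 n2 n3 p q r s α γ) (hs0 : s = 0) {h : ℤ} (hh : memZ H h) :
    h ∈ trace H := by
  obtain ⟨m, hm, rfl⟩ := hh
  refine ⟨_, ⟨_, d.f2_pf, m, hm, rfl⟩, -n1 + (q - s - 1) * n2 + (γ - 1) * n3, ?_, by ring⟩
  rintro w ⟨f, hf, k, hk, rfl⟩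
  rcases d.pf_cases hf with rfl | ⟨h, -⟩
  · exact ⟨k, hk, by ring⟩
  · omega

lemma mem_trace (d : Dat H n1 n2 n3 p q r s α γ) (hs1 : 0 < s) {h : ℤ} (hh : memZ H h) :
    h ∈ trace H ↔ memZ H (h + ((q - s) * n2 - r * n1)) ∨ memZ H (h - ((q - s) * n2 - r * n1)) := by
  have e1 := d.rel1
  have h0 : 0 ∈ H := by
    obtain ⟨m, hm, e⟩ := (d.hH 0).2 ⟨0, 0, 0, le_rfl, le_rfl, le_rfl, by ring⟩
    have : m = 0 := by exact_mod_cast e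
    exact this ▸ hm
  constructor
  · rintro ⟨w, ⟨f, hf, k, hk, rfl⟩, x, hx, rfl⟩
    have hk' : memZ H k := ⟨k, hk, rfl⟩
    have y1 := d.add (hx _ ⟨_, d.f1_pf hs1, 0, h0, rfl⟩) hk'
    have y2 := d.add (hx _ ⟨_, d.f2_pf, 0, h0, rfl⟩) hk'
    rcases d.pf_cases hf with rfl | ⟨-, rfl⟩
    · left
      convert y1 using 1
      push_cast
      linear_combination e1
    · right
      convert y2 using 1
      push_cast
      linear_combination -e1
  · obtain ⟨m, hm, rfl⟩ := hh
    rintro (⟨k, hk, e⟩ | ⟨k, hk, e⟩)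
    · refine ⟨_, ⟨_, d.f2_pf, 0, h0, rfl⟩, m + (-n1 + (q - s - 1) * n2 + (γ - 1) * n3), ?_,
        by push_cast; ring⟩
      rintro w ⟨f, hf, l, hl, rfl⟩
      rcases d.pf_cases hf with rfl | ⟨-, rfl⟩
      · convert d.add ⟨m, hm, rfl⟩ ⟨l, hl, rfl⟩ using 1; ring
      · convert d.add ⟨k, hk, rfl⟩ ⟨l, hl, rfl⟩ using 1
        rw [e]; linear_combination -e1
    · refine ⟨_, ⟨_, d.f1_pf hs1, 0, h0, rfl⟩, m + (-n1 + (q - 1) * n2 + (γ - p - 1) * n3), ?_,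
        by push_cast; ring⟩
      rintro w ⟨f, hf, l, hl, rfl⟩
      rcases d.pf_cases hf with rfl | ⟨-, rfl⟩
      · convert d.add ⟨k, hk, rfl⟩ ⟨l, hl, rfl⟩ using 1
        rw [e]; linear_combination e1
      · convert d.add ⟨m, hm, rfl⟩ ⟨l, hl, rfl⟩ using 1; ring

/-- Elements outside of the trace, in coordinates. -/
lemma not_trace (d : Dat H n1 n2 n3 p q r s α γ) (hs1 : 0 < s) {A B C : ℤ}
    (hA : 0 ≤ A) (hB : 0 ≤ B) (hC : 0 ≤ C) :
    A * n1 + B * n2 + C * n3 ∉ trace H ↔ A < r ∧ B < min s (q - s) ∧ C < p := by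
  have hp := d.hp; have hr := d.hr; have hs := d.hs; have hsq := d.hsq
  have hγ := d.hγ; have hα := d.hα; have e1 := d.rel1; have e2 := d.rel2
  rw [d.mem_trace hs1 ((d.hH _).2 ⟨A, B, C, hA, hB, hC, rfl⟩), lt_min_iff]
  constructor
  · intro h
    push Not at h
    obtain ⟨g1, g2⟩ := h
    rw [d.hH] at g1 g2
    refine ⟨?_, ⟨?_, ?_⟩, ?_⟩ <;> by_contra hc
    · exact g1 ⟨A - r, B + (q - s), C, by omega, by omega, by omega, by ring⟩
    · exact g1 ⟨A, B - s, C + p, by omega, by omega, by omega, by linarith⟩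
    · exact g2 ⟨A + r, B - (q - s), C, by omega, by omega, by omega, by ring⟩
    · exact g2 ⟨A, B + s, C - p, by omega, by omega, by omega, by linarith⟩
  · rintro ⟨hA', ⟨hB1, hB2⟩, hC'⟩
    rintro (g | g) <;> rw [d.hH] at g <;> obtain ⟨A', B', C', a1, a2, a3, e⟩ := g
    · obtain ⟨i, k, l1, l2, l3⟩ := d.lat (A' - A + r) (B' - B - (q - s)) (C' - C) (by linarith)
      rcases lt_trichotomy k 0 with hk | hk | hk
      · have b1 := auxA (c := 0) hr hα hk.le (i := i) (by linarith)
        have b2 := auxB' (c := 2) hs hsq (k := k - 2 + 2) (by omega) (i := i) (by linarith)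
        omega
      · subst hk
        have b3 := auxC (c := 1) hp hγ (k := 0) le_rfl (i := i) (by linarith)
        have b1 := auxA (c := 0) hr hα (k := 0) le_rfl (i := i) (by linarith)
        have b2 := auxB (c := 1) hs hsq (k := 0) (by omega) (i := i) (by linarith)
        omega
      · have b1 := auxC (c := 1) hp hγ hk.le (i := i) (by linarith)
        have b2 := auxB (c := 1) hs hsq hk.le (i := i) (by linarith)
        omega
    · obtain ⟨i, k, l1, l2, l3⟩ := d.lat (A' - A - r) (B' - B + (q - s)) (C' - C) (by linarith)
      rcases le_or_gt k 0 with hk | hk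
      · have b2 := auxB' (c := 0) hs hsq hk (i := i) (by linarith)
        rcases lt_or_eq_of_le hk with hk' | rfl
        · have b1 := auxA (c := 2) hr hα hk (i := i) (by linarith)
          omega
        · have b3 := auxC (c := 1) hp hγ (k := 0) le_rfl (i := i) (by linarith)
          omega
      · have b1 := auxC (c := 1) hp hγ hk.le (i := i) (by linarith)
        have b2 := auxB (c := 0) hs hsq hk.le (i := i) (by linarith)
        omega

/-- Uniqueness of factorization for small exponents. -/
lemma inj (d : Dat H n1 n2 n3 p q r s α γ) {A B C A' B' C' : ℤ}
    (hA : 0 ≤ A) (hB : 0 ≤ B) (hC : 0 ≤ C) (hA' : A < r) (hB' : B < min s (q - s)) (hC' : C < p)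
    (gA : 0 ≤ A') (gB : 0 ≤ B') (gC : 0 ≤ C') (gA' : A' < r) (gB' : B' < min s (q - s)) (gC' : C' < p)
    (e : A * n1 + B * n2 + C * n3 = A' * n1 + B' * n2 + C' * n3) : A = A' ∧ B = B' ∧ C = C' := by
  have hp := d.hp; have hr := d.hr; have hs := d.hs; have hsq := d.hsq
  have hγ := d.hγ; have hα := d.hα
  rw [lt_min_iff] at hB' gB'
  obtain ⟨i, k, l1, l2, l3⟩ := d.lat (A - A') (B - B') (C - C') (by linarith)
  have hk : k = 0 := by
    rcases lt_trichotomy k 0 with hk | hk | hk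
    · have b1 := auxA (c := 1) hr hα hk.le (i := i) (by linarith)
      have b2 := auxB' (c := 1) hs hsq hk.le (i := i) (by linarith)
      have b3 := auxC (c := 1) hp hγ (k := -k) (by omega) (i := -i) (by linarith)
      omega
    · exact hk
    · have b1 := auxC (c := 1) hp hγ hk.le (i := i) (by linarith)
      have b3 := auxA (c := 1) hr hα (k := -k) (by omega) (i := -i) (by linarith)
      omega
  subst hk
  have b3 := auxC (c := 1) hp hγ (k := 0) le_rfl (i := i) (by linarith)
  have b4 := auxC (c := 1) hp hγ (k := 0) le_rfl (i := -i) (by linarith)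
  have : i = 0 := by omega
  subst this
  refine ⟨by linarith, by linarith, by linarith⟩

lemma res_eq (d : Dat H n1 n2 n3 p q r s α γ) :
    res H = r.toNat * (min s (q - s)).toNat * p.toNat := by
  rcases lt_or_eq_of_le d.hs with hs | hs
  swap
  · have : {h : ℕ | h ∈ H ∧ (h : ℤ) ∉ trace H} = ∅ := by
      ext h
      simp only [Set.mem_ofPred_eq, Set.mem_empty_iff_false, iff_false, not_and, not_not]
      intro hh
      exact d.trace_zero hs.symm ⟨h, hh, rfl⟩
    have h1 : min s (q - s) = 0 := by have := d.hsq; omega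
    rw [res, this, h1]; simp
  · set F := (Finset.range r.toNat ×ˢ Finset.range (min s (q - s)).toNat) ×ˢ Finset.range p.toNat
    have hF : F.card = r.toNat * (min s (q - s)).toNat * p.toNat := by simp [F]
    set φ : (ℕ × ℕ) × ℕ → ℕ := fun t => ((t.1.1 : ℤ) * n1 + t.1.2 * n2 + t.2 * n3).toNat with hφ
    have h1 := d.h1; have h2 := d.h2; have h3 := d.h3
    have hφ' : ∀ t, ((φ t : ℕ) : ℤ) = (t.1.1 : ℤ) * n1 + t.1.2 * n2 + t.2 * n3 := fun t =>
      Int.toNat_of_nonneg (by positivity)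
    have hmem : ∀ t, t ∈ F ↔ (t.1.1 : ℤ) < r ∧ (t.1.2 : ℤ) < min s (q - s) ∧ (t.2 : ℤ) < p := by
      intro t
      simp only [F, Finset.mem_product, Finset.mem_range]
      omega
    have hset : {h : ℕ | h ∈ H ∧ (h : ℤ) ∉ trace H} = φ '' (F : Set ((ℕ × ℕ) × ℕ)) := by
      ext h
      simp only [Set.mem_ofPred_eq, Set.mem_image, Finset.mem_coe]
      constructor
      · rintro ⟨hh, ht⟩
        obtain ⟨A, B, C, hA, hB, hC, e⟩ := (d.hH h).1 ⟨h, hh, rfl⟩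
        rw [e, d.not_trace hs hA hB hC] at ht
        refine ⟨((A.toNat, B.toNat), C.toNat), (hmem _).2 ?_, ?_⟩
        · simpa only [Int.toNat_of_nonneg hA, Int.toNat_of_nonneg hB, Int.toNat_of_nonneg hC] using ht
        · have := hφ' ((A.toNat, B.toNat), C.toNat)
          simp only [Int.toNat_of_nonneg hA, Int.toNat_of_nonneg hB, Int.toNat_of_nonneg hC] at this
          rw [← e] at this
          exact_mod_cast this
      · rintro ⟨t, ht, rfl⟩
        rw [hφ', d.not_trace hs (by positivity) (by positivity) (by positivity)]
        refine ⟨?_, (hmem t).1 ht⟩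
        obtain ⟨m, hm, e⟩ := (d.hH (φ t)).2 ⟨t.1.1, t.1.2, t.2, by positivity, by positivity,
          by positivity, hφ' t⟩
        have : m = φ t := by exact_mod_cast e
        exact this ▸ hm
    rw [res, hset, Set.ncard_image_of_injOn, Set.ncard_coe_finset, hF]
    intro t ht t' ht' e
    rw [Finset.mem_coe, hmem] at ht ht'
    have e' : ((φ t : ℕ) : ℤ) = φ t' := by rw [e]
    rw [hφ', hφ'] at e'
    obtain ⟨u1, u2, u3⟩ := d.inj (by positivity) (by positivity) (by positivity) ht.1 ht.2.1 ht.2.2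
      (by positivity) (by positivity) (by positivity) ht'.1 ht'.2.1 ht'.2.2 e'
    ext
    · exact_mod_cast u1
    · exact_mod_cast u2
    · exact_mod_cast u3

end Dat

lemma mem_gen (x y z n : ℕ) :
    n ∈ genBy {x, y, z} ↔ ∃ A B C : ℕ, n = A * x + B * y + C * z := by
  unfold genBy
  rw [SetLike.mem_coe]
  constructor
  · intro h
    induction h using AddSubmonoid.closure_induction with
    | mem t ht =>
      simp only [Set.mem_insert_iff, Set.mem_singleton_iff] at ht
      rcases ht with rfl | rfl | rfl
      · exact ⟨1, 0, 0, by ring⟩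
      · exact ⟨0, 1, 0, by ring⟩
      · exact ⟨0, 0, 1, by ring⟩
    | zero => exact ⟨0, 0, 0, by ring⟩
    | add t u _ _ h1 h2 =>
      obtain ⟨A, B, C, rfl⟩ := h1
      obtain ⟨A', B', C', rfl⟩ := h2
      exact ⟨A + A', B + B', C + C', by ring⟩
  · rintro ⟨A, B, C, rfl⟩
    have hx : x ∈ AddSubmonoid.closure {x, y, z} := AddSubmonoid.subset_closure (by simp)
    have hy : y ∈ AddSubmonoid.closure {x, y, z} := AddSubmonoid.subset_closure (by simp)
    have hz : z ∈ AddSubmonoid.closure {x, y, z} := AddSubmonoid.subset_closure (by simp)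
    exact add_mem (add_mem (nsmul_mem hx A) (nsmul_mem hy B)) (nsmul_mem hz C)

lemma gcdSet_eq (g x y z : ℕ) (hg : 0 < g) (hc : ∀ e, e ∣ x → e ∣ y → e ∣ z → e = 1) :
    gcdSet (genBy {g * x, g * y, g * z}) = g := by
  have hset : {d : ℕ | ∀ s ∈ genBy {g * x, g * y, g * z}, d ∣ s} = {d : ℕ | d ∣ g} := by
    ext d
    simp only [Set.mem_ofPred_eq]
    constructor
    · intro h
      have d1 : d ∣ g * x := h _ ((mem_gen _ _ _ _).2 ⟨1, 0, 0, by ring⟩)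
      have d2 : d ∣ g * y := h _ ((mem_gen _ _ _ _).2 ⟨0, 1, 0, by ring⟩)
      have d3 : d ∣ g * z := h _ ((mem_gen _ _ _ _).2 ⟨0, 0, 1, by ring⟩)
      have h4 : Nat.gcd x (Nat.gcd y z) = 1 := hc _ (Nat.gcd_dvd_left _ _)
        ((Nat.gcd_dvd_right _ _).trans (Nat.gcd_dvd_left _ _))
        ((Nat.gcd_dvd_right _ _).trans (Nat.gcd_dvd_right _ _))
      have h5 := Nat.dvd_gcd d1 (Nat.dvd_gcd d2 d3)
      rwa [Nat.gcd_mul_left, Nat.gcd_mul_left, h4, mul_one] at h5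
    · rintro h s hs
      obtain ⟨A, B, C, rfl⟩ := (mem_gen _ _ _ _).1 hs
      exact h.trans ⟨A * x + B * y + C * z, by ring⟩
  unfold gcdSet
  rw [hset]
  apply le_antisymm
  · exact csSup_le ⟨g, dvd_rfl⟩ (fun d hd => Nat.le_of_dvd hg hd)
  · exact le_csSup ⟨g, fun d hd => Nat.le_of_dvd hg hd⟩ dvd_rfl

lemma divGcd_mem (g x y z : ℕ) (hg : 0 < g) (hc : ∀ e, e ∣ x → e ∣ y → e ∣ z → e = 1) (n : ℤ) :
    memZ (divGcd (genBy {g * x, g * y, g * z})) n ↔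
      ∃ A B C : ℤ, 0 ≤ A ∧ 0 ≤ B ∧ 0 ≤ C ∧ n = A * x + B * y + C * z := by
  unfold memZ divGcd
  rw [gcdSet_eq g x y z hg hc]
  constructor
  · rintro ⟨m, ⟨t, ht, rfl⟩, rfl⟩
    obtain ⟨A, B, C, rfl⟩ := (mem_gen _ _ _ _).1 ht
    refine ⟨A, B, C, by positivity, by positivity, by positivity, ?_⟩
    have : A * (g * x) + B * (g * y) + C * (g * z) = g * (A * x + B * y + C * z) := by ring
    simp only [this, Nat.mul_div_cancel_left _ hg]
    push_cast; ring
  · rintro ⟨A, B, C, hA, hB, hC, rfl⟩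
    lift A to ℕ using hA
    lift B to ℕ using hB
    lift C to ℕ using hC
    refine ⟨A * x + B * y + C * z, ⟨A * (g * x) + B * (g * y) + C * (g * z),
      (mem_gen _ _ _ _).2 ⟨A, B, C, rfl⟩, ?_⟩, by push_cast; ring⟩
    have : A * (g * x) + B * (g * y) + C * (g * z) = g * (A * x + B * y + C * z) := by ring
    simp only [this, Nat.mul_div_cancel_left _ hg]

lemma mk_dat (H : Set ℕ) (j D p q r : ℤ) (hj : 0 < j) (hD : 0 < D) (hp : 0 < p) (hr : 0 < r)
    (hq : q = p + r) (hjD : IsCoprime j D) (hpq : IsCoprime p q)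
    (k1 : 2 * (D * q * (r - 1)) < j) (k2 : 2 * (D * p * q) < j)
    (hH : ∀ z : ℤ, memZ H z ↔ ∃ A B C : ℤ, 0 ≤ A ∧ 0 ≤ B ∧ 0 ≤ C ∧
      z = A * j + B * (j + D * p) + C * (j + D * q)) :
    ∃ s α γ : ℤ, Dat H j (j + D * p) (j + D * q) p q r s α γ := by
  have hq0 : 0 < q := by omega
  obtain ⟨u, v, huv⟩ := hpq
  set s := (-j * u) % q with hs
  have hs0 : 0 ≤ s := Int.emod_nonneg _ hq0.ne'
  have hsq : s < q := Int.emod_lt_of_pos _ hq0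
  obtain ⟨γ, hγ⟩ : q ∣ j + p * s := by
    have h1 : s = -j * u - q * (-j * u / q) := by
      rw [hs]; have := Int.emod_add_mul_ediv (-j * u) q; linarith
    refine ⟨j * v - p * (-j * u / q), ?_⟩
    rw [h1]
    linear_combination (-j) * huv
  have hps : 0 ≤ p * s := by positivity
  have hDp : p ≤ D * p := by nlinarith
  refine ⟨s, D + γ - s, γ, ⟨hH, hj, by positivity, by positivity, hp, hr, hs0, hsq, ?_, ?_, ?_, ?_, ?_, ?_⟩⟩
  · by_contra hc
    push Not at hc
    nlinarith
  · by_contra hc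
    push Not at hc
    have c1 : D + γ - s ≤ r - 1 := by omega
    have c2 : q * (D + γ - s) ≤ q * (r - 1) := mul_le_mul_of_nonneg_left c1 hq0.le
    have c3 : r * s ≤ r * (q - 1) := mul_le_mul_of_nonneg_left (by omega) hr.le
    have c4 : 0 ≤ (D - 1) * (q * (r - 1)) :=
      mul_nonneg (by omega) (mul_nonneg hq0.le (by omega))
    have c5 : 0 ≤ (D - 1) * q := mul_nonneg (by omega) hq0.le
    subst hq
    nlinarith
  · subst hq; ring
  · linear_combination -D * hγ
  · intro x y z h
    have h' : j * (x + y + z) + D * (p * y + q * z) = 0 := by linear_combination h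
    obtain ⟨t, ht⟩ : D ∣ x + y + z := by
      apply hjD.symm.dvd_of_dvd_mul_left
      exact ⟨-(p * y + q * z), by linarith⟩
    have h2 : j * t + p * y + q * z = 0 := by
      have : D * (j * t + p * y + q * z) = 0 := by rw [ht] at h'; linear_combination h'
      rcases mul_eq_zero.1 this with h | h
      · omega
      · exact h
    have h3 : p * (y - t * s) + q * (z + t * γ) = 0 := by linear_combination h2 - t * hγ
    obtain ⟨i, hi⟩ : q ∣ y - t * s := by
      have hc : IsCoprime p q := ⟨u, v, huv⟩
      apply hc.symm.dvd_of_dvd_mul_left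
      exact ⟨-(z + t * γ), by linarith⟩
    have h4 : z + t * γ = - p * i := by
      have : q * (z + t * γ + p * i) = 0 := by rw [hi] at h3; linear_combination h3
      rcases mul_eq_zero.1 this with h | h
      · omega
      · linarith
    refine ⟨-i, t, ?_, by linarith, by linarith⟩
    subst hq
    linear_combination ht - hi - h4
  · obtain ⟨e, f, hef⟩ := hjD
    exact ⟨e - f * u - f * v, f * u, f * v, by linear_combination hef + D * f * huv⟩

lemma final_bound (p q r m : ℕ) (hp : 0 < p) (hr : 0 < r) (hq : q = p + r) (hm : 2 * m ≤ q) :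
    27 * (r * m * p) < 8 * q ^ 3 := by
  have h1 : 4 * (r * p) ≤ q ^ 2 := by
    subst hq; zify; nlinarith [sq_nonneg ((p : ℤ) - r)]
  have h2 : 4 * (r * p) * (2 * m) ≤ q ^ 2 * q := Nat.mul_le_mul h1 hm
  have h3 : 0 < q ^ 3 := by subst hq; positivity
  nlinarith

end Stmt14

/-- for `0 < a < b`, `D = gcd(a,b)`, `k = max{b((b-a)/D - 1), ab/D}`
and `H_j = ⟨j, j+a, j+b⟩`, for all `j > 2k` the integer `a(b-a)/D²` divides
`res(H_j)` and `res(H_j) < 8b³/(27D³)`. -/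
theorem stmt_14 (a b : ℕ) (ha : 0 < a) (hab : a < b)
    (D k : ℕ) (hD : D = Nat.gcd a b)
    (hk : k = max (b * ((b - a) / D - 1)) (a * b / D)) :
    ∀ j : ℕ, 1 ≤ j → 2 * k < j →
      (a * (b - a) / D ^ 2) ∣ resExt (genBy {j, j + a, j + b}) ∧
      27 * D ^ 3 * resExt (genBy {j, j + a, j + b}) < 8 * b ^ 3 := by
  intro j hj hkj
  obtain ⟨p, q, hpq, hap, hbq⟩ := Nat.exists_coprime a b
  rw [← hD] at hap hbq
  have hD0 : 0 < D := hD ▸ Nat.gcd_pos_of_pos_left _ ha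
  obtain ⟨j0, D0, hjD, hj0, hDD⟩ := Nat.exists_coprime j D
  have hg : 0 < Nat.gcd j D := Nat.gcd_pos_of_pos_left _ hj
  set g := Nat.gcd j D with hgdef
  clear_value g
  have hp : 0 < p := by rcases Nat.eq_zero_or_pos p with h | h; · simp [h] at hap; omega
                        · exact h
  have hpltq : p < q := by
    by_contra hc
    push Not at hc
    have := Nat.mul_le_mul_right D hc
    omega
  obtain ⟨r, hr⟩ := Nat.exists_eq_add_of_lt hpltq
  obtain ⟨r', hr'⟩ : ∃ r', r' = r + 1 := ⟨_, rfl⟩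
  have hq : q = p + r' := by omega
  have hr0 : 0 < r' := by omega
  have hba : b - a = r' * D := by rw [hap, hbq, hq, ← Nat.sub_mul]; simp
  have hk1 : b * (r' - 1) ≤ k := by
    rw [hk, hba, Nat.mul_div_cancel _ hD0]; exact le_max_left _ _
  have hk2 : p * b ≤ k := by
    have : a * b / D = p * b := by
      rw [hap, show p * D * b = p * b * D by ring, Nat.mul_div_cancel _ hD0]
    rw [hk, this]; exact le_max_right _ _
  have hdiv : a * (b - a) / D ^ 2 = r' * p := by
    rw [hba, hap, show p * D * (r' * D) = r' * p * D ^ 2 by ring,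
      Nat.mul_div_cancel _ (by positivity)]
  have hj0' : 0 < j0 := by
    rcases Nat.eq_zero_or_pos j0 with h | h
    · simp [h] at hj0; omega
    · exact h
  have hD0' : 0 < D0 := by
    rcases Nat.eq_zero_or_pos D0 with h | h
    · simp [h] at hDD; omega
    · exact h
  have hgen : ({j, j + a, j + b} : Set ℕ) =
      {g * j0, g * (j0 + D0 * p), g * (j0 + D0 * q)} := by
    have e1 : j = g * j0 := by rw [hj0]; ring
    have e2 : j + a = g * (j0 + D0 * p) := by rw [hap, hj0, hDD]; ring
    have e3 : j + b = g * (j0 + D0 * q) := by rw [hbq, hj0, hDD]; ring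
    rw [e2, e3, e1]
  have hc : ∀ e, e ∣ j0 → e ∣ j0 + D0 * p → e ∣ j0 + D0 * q → e = 1 := by
    intro e h1 h2 h3
    have h2' := (Nat.dvd_add_right h1).1 h2
    have h3' := (Nat.dvd_add_right h1).1 h3
    have h4 := Nat.dvd_gcd h2' h3'
    rw [Nat.gcd_mul_left, hpq.gcd_eq_one, mul_one] at h4
    exact Nat.eq_one_of_dvd_coprimes hjD h1 h4
  have b1 : 2 * (D0 * q * (r' - 1)) < j0 := by
    apply Nat.lt_of_mul_lt_mul_right (a := g)
    calc 2 * (D0 * q * (r' - 1)) * g = 2 * (b * (r' - 1)) := by rw [hbq, hDD]; ring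
      _ ≤ 2 * k := by omega
      _ < j0 * g := by omega
  have b2 : 2 * (D0 * p * q) < j0 := by
    apply Nat.lt_of_mul_lt_mul_right (a := g)
    calc 2 * (D0 * p * q) * g = 2 * (p * b) := by rw [hbq, hDD]; ring
      _ ≤ 2 * k := by omega
      _ < j0 * g := by omega
  obtain ⟨s, α, γ, d⟩ := Stmt14.mk_dat (divGcd (genBy {j, j + a, j + b})) j0 D0 p q r'
    (by exact_mod_cast hj0') (by exact_mod_cast hD0') (by exact_mod_cast hp)
    (by exact_mod_cast hr0) (by exact_mod_cast hq) (Nat.isCoprime_iff_coprime.2 hjD)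
    (Nat.isCoprime_iff_coprime.2 hpq)
    (by rw [show (r' : ℤ) - 1 = ((r' - 1 : ℕ) : ℤ) by omega]; exact_mod_cast b1)
    (by exact_mod_cast b2)
    (by
      intro z
      rw [hgen, Stmt14.divGcd_mem g _ _ _ hg hc]
      push_cast
      rfl)
  have hres := d.res_eq
  unfold resExt
  rw [hres, hdiv]
  simp only [Int.toNat_natCast]
  generalize hm : (min s ((q : ℤ) - s)).toNat = m
  have hm2 : 2 * m ≤ q := by omega
  refine ⟨⟨m, by ring⟩, ?_⟩
  have := Stmt14.final_bound p q r' m hp hr0 hq hm2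
  calc 27 * D ^ 3 * (r' * m * p) = D ^ 3 * (27 * (r' * m * p)) := by ring
    _ < D ^ 3 * (8 * q ^ 3) := Nat.mul_lt_mul_of_pos_left this (by positivity)
    _ = 8 * b ^ 3 := by rw [hbq]; ring
end

section
/- Let 0 < a < b be integers, D = gcd(a,b), and k_{a,b} = max{b·((b−a)/D − 1), a·b/D}. For an integer j ≥ 1 let H_j denote the additive submonoid of ℕ generated by {j, j+a, j+b}. Then for all j > 2k_{a,b}, H_j is nearly Gorenstein if and only if H_{j+b} is nearly Gorenstein. -/
open NumSgp


/-- The numerical data attached to `⟨x, y, z⟩` with relations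
`(p+q) y = p x + q z`, `W z = u x + v y`. -/
structure SU (H : Set ℕ) (p q D v u W x y z : ℤ) : Prop where
  hp : 1 ≤ p
  hq : 1 ≤ q
  hD : 1 ≤ D
  hv : 0 ≤ v
  hvc : v < p + q
  hu : 2 ≤ u
  hW : q + 2 ≤ W
  hx : x = (p + q) * W - v * q
  hud : u = D - v + W
  hy : y = x + D * q
  hz : z = x + D * (p + q)
  cop : IsCoprime p q
  cop2 : IsCoprime x D
  hz2 : z < 2 * x
  hmem : ∀ n, memZ H n ↔ ∃ s t r : ℤ, 0 ≤ s ∧ 0 ≤ t ∧ 0 ≤ r ∧ n = s * x + t * y + r * z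

/-- normal exponents -/
def Nrm (p q v W t r : ℤ) : Prop :=
  0 ≤ t ∧ 0 ≤ r ∧ t < p + q ∧ r < W ∧ (t < p + q - v ∨ r < W - q)

namespace SU

variable {H : Set ℕ} {p q D v u W x y z : ℤ}

theorem xpos (S : SU H p q D v u W x y z) : 0 < x := by
  have := S.hD; have := S.hp; have := S.hq; have := S.hz; have := S.hz2
  nlinarith [mul_pos (show 0 < D by linarith) (show 0 < p + q by linarith)]

theorem relA (S : SU H p q D v u W x y z) : (p + q) * y = p * x + q * z := by
  rw [S.hy, S.hz]; ring

theorem relB (S : SU H p q D v u W x y z) : W * z = u * x + v * y := by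
  have h := S.hx
  rw [S.hy, S.hz, S.hud]; linear_combination (-D) * h

theorem lattice (S : SU H p q D v u W x y z) {s t r : ℤ}
    (h : s * x + t * y + r * z = 0) :
    ∃ m l : ℤ, s = m * p + l * u ∧ t = l * v - m * (p + q) ∧ r = m * q - l * W := by
  have h1 : (s + t + r) * x = D * (-(t * q + r * (p + q))) := by
    rw [S.hy, S.hz] at h; linear_combination h
  obtain ⟨l, hl⟩ : D ∣ s + t + r := S.cop2.symm.dvd_of_dvd_mul_right ⟨_, h1⟩
  have hD := S.hD
  have h2 : l * x = -(t * q + r * (p + q)) := by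
    have : D * (l * x) = D * (-(t * q + r * (p + q))) := by rw [← h1, hl]; ring
    exact mul_left_cancel₀ (by omega) this
  have h3 : (l * v - t) * q = (p + q) * (r + l * W) := by
    rw [S.hx] at h2; linear_combination (-1) * h2
  have hc : IsCoprime (p + q) q := by
    have := S.cop.add_mul_right_left 1
    simpa using this
  obtain ⟨m, hm⟩ : (p + q) ∣ l * v - t := hc.dvd_of_dvd_mul_right ⟨_, h3⟩
  have hpq : (p + q) ≠ 0 := by have := S.hp; have := S.hq; omega
  have h4 : m * q = r + l * W := by
    have : (p + q) * (m * q) = (p + q) * (r + l * W) := by rw [← h3, hm]; ring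
    exact mul_left_cancel₀ hpq this
  refine ⟨m, l, ?_, ?_, ?_⟩
  · have := S.hud
    subst this
    linear_combination hl + hm + h4
  · linear_combination -hm
  · linear_combination -h4

theorem not_mem (S : SU H p q D v u W x y z) {s t r : ℤ} (hs : s < 0)
    (hn : Nrm p q v W t r) : ¬ memZ H (s * x + t * y + r * z) := by
  rw [S.hmem]
  rintro ⟨s', t', r', hs', ht', hr', he⟩
  obtain ⟨m, l, h1, h2, h3⟩ := S.lattice (s := s' - s) (t := t' - t) (r := r' - r)
    (by linear_combination -he)
  obtain ⟨n1, n2, n3, n4, n5⟩ := hn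
  have := S.hp; have := S.hq; have := S.hu; have := S.hW; have := S.hv; have := S.hvc
  have e1 : 1 ≤ m * p + l * u := by omega
  have e2 : m * (p + q) - l * v ≤ t := by omega
  have e3 : l * W - m * q ≤ r := by omega
  rcases le_or_gt l 0 with hl | hl
  · have hm : 1 ≤ m := by
      by_contra hm
      have hm : m ≤ 0 := by omega
      nlinarith
    nlinarith
  · have hm : 1 ≤ m := by
      by_contra hm
      have hm : m ≤ 0 := by omega
      nlinarith
    rcases lt_trichotomy m l with hml | hml | hml
    · have : m * W ≤ (l - 1) * W := by apply mul_le_mul_of_nonneg_right <;> omega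
      nlinarith
    · subst hml
      rcases n5 with n5 | n5
      · nlinarith
      · nlinarith
    · have : l * (p + q) ≤ (m - 1) * (p + q) := by apply mul_le_mul_of_nonneg_right <;> omega
      nlinarith

theorem mem_iff (S : SU H p q D v u W x y z) {s t r : ℤ} 
    (hn : Nrm p q v W t r) : memZ H (s * x + t * y + r * z) ↔ 0 ≤ s := by
  constructor
  · intro h
    by_contra hs
    exact S.not_mem (by omega) hn h
  · intro h
    exact (S.hmem _).2 ⟨s, t, r, h, hn.1, hn.2.1, rfl⟩

theorem nf_aux (S : SU H p q D v u W x y z) (N : ℕ) : ∀ s t r : ℤ, 0 ≤ t → 0 ≤ r →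
    t * y + r * z ≤ N → ∃ s' t' r', Nrm p q v W t' r' ∧
      s * x + t * y + r * z = s' * x + t' * y + r' * z := by
  induction N with
  | zero =>
    intro s t r ht hr h
    have hx := S.xpos
    have := S.hp; have := S.hq; have := S.hW; have := S.hvc; have := S.hD
    have hy : 0 < y := by rw [S.hy]; positivity
    have hz : 0 < z := by rw [S.hz]; positivity
    have h1 := mul_nonneg ht hy.le
    have h2 := mul_nonneg hr hz.le
    have t0 : t = 0 := by
      have : t * y = 0 := by push_cast at h; linarith
      rcases mul_eq_zero.1 this with h | h <;> omega
    have r0 : r = 0 := by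
      have : r * z = 0 := by push_cast at h; linarith
      rcases mul_eq_zero.1 this with h | h <;> omega
    exact ⟨s, t, r, ⟨ht, hr, by omega, by omega, by omega⟩, rfl⟩
  | succ N ih =>
    intro s t r ht hr h
    have hx := S.xpos
    have := S.hp; have := S.hq; have := S.hW; have := S.hvc; have := S.hD; have := S.hv
    have := S.hu
    have A := S.relA
    have B := S.relB
    push_cast at h
    by_cases hn : Nrm p q v W t r
    · exact ⟨s, t, r, hn, rfl⟩
    by_cases h1 : p + q ≤ t
    · obtain ⟨s', t', r', hh, e⟩ := ih (s + p) (t - (p + q)) (r + q) (by omega) (by omega)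
        (by nlinarith)
      exact ⟨s', t', r', hh, by rw [← e]; linear_combination A⟩
    by_cases h2 : W ≤ r
    · obtain ⟨s', t', r', hh, e⟩ := ih (s + u) (t + v) (r - W) (by omega) (by omega)
        (by nlinarith)
      exact ⟨s', t', r', hh, by rw [← e]; linear_combination B⟩
    have h3 : p + q - v ≤ t ∧ W - q ≤ r := by
      constructor
      · by_contra h3
        exact hn ⟨ht, hr, by omega, by omega, by omega⟩
      · by_contra h3
        exact hn ⟨ht, hr, by omega, by omega, by omega⟩
    obtain ⟨s', t', r', hh, e⟩ := ih (s + u + p) (t - (p + q - v)) (r - (W - q))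
        (by omega) (by omega) (by nlinarith)
    exact ⟨s', t', r', hh, by rw [← e]; linear_combination A + B⟩

theorem nf (S : SU H p q D v u W x y z) (n : ℤ) :
    ∃ s t r, Nrm p q v W t r ∧ n = s * x + t * y + r * z := by
  obtain ⟨α, β, h1⟩ := S.cop2
  have hc : IsCoprime q (p + q) := by
    have := S.cop.add_mul_right_left 1
    simpa using this.symm
  obtain ⟨γ, δ, h2⟩ := hc
  have hx := S.xpos
  have e1 : n = (n * α - n * β * γ - n * β * δ) * x + (n * β * γ) * y + (n * β * δ) * z := by
    rw [S.hy, S.hz]; linear_combination (-n) * h1 - n * β * D * h2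
  have d1 := Int.emod_add_mul_ediv (n * β * γ) x
  have d2 := Int.emod_add_mul_ediv (n * β * δ) x
  obtain ⟨s', t', r', hh, e⟩ := S.nf_aux
    (((n * β * γ) % x) * y + ((n * β * δ) % x) * z).toNat
    ((n * α - n * β * γ - n * β * δ) + (n * β * γ) / x * y + (n * β * δ) / x * z)
    ((n * β * γ) % x) ((n * β * δ) % x)
    (Int.emod_nonneg _ hx.ne') (Int.emod_nonneg _ hx.ne') (Int.self_le_toNat _)
  refine ⟨s', t', r', hh, ?_⟩
  rw [← e]
  linear_combination e1 - y * d1 - z * d2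

/-- membership of elements of H -/
theorem memZ_coe (S : Set ℕ) {h : ℕ} (hh : h ∈ S) : memZ S (h : ℤ) := ⟨h, hh, rfl⟩

theorem add_mem (S : SU H p q D v u W x y z) {m n : ℤ} (hm : memZ H m) (hn : memZ H n) :
    memZ H (m + n) := by
  rw [S.hmem] at *
  obtain ⟨s, t, r, h1, h2, h3, rfl⟩ := hm
  obtain ⟨s', t', r', h1', h2', h3', rfl⟩ := hn
  exact ⟨s + s', t + t', r + r', by omega, by omega, by omega, by ring⟩

theorem nonneg_mem {n : ℤ} (h : memZ H n) : 0 ≤ n := by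
  obtain ⟨m, -, rfl⟩ := h; omega

/-- symmetric case -/
theorem sym (S : SU H p q D v u W x y z) (hv : v = 0) : NearlyGorenstein H := by
  have := S.hp; have := S.hq; have := S.hW
  set F : ℤ := (-1) * x + (p + q - 1) * y + (W - 1) * z with hF
  have hF1 : ¬ memZ H F := S.not_mem (by omega) ⟨by omega, by omega, by omega, by omega, by omega⟩
  have hF2 : ∀ n, ¬ memZ H n → memZ H (F - n) := by
    intro n hn
    obtain ⟨s, t, r, hh, e⟩ := S.nf n
    have hs : ¬ 0 ≤ s := by
      rw [e, S.mem_iff hh] at hn; exact hn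
    obtain ⟨n1, n2, n3, n4, n5⟩ := hh
    exact (S.hmem _).2 ⟨-1 - s, p + q - 1 - t, W - 1 - r, by omega, by omega, by omega, by
      rw [e, hF]; ring⟩
  have hF3 : F ∈ pseudoFrob H := by
    refine ⟨hF1, fun m hm h0 => ?_⟩
    by_contra hc
    have := nonneg_mem (hF2 _ hc)
    omega
  intro h hh h0
  refine ⟨-F + h, ⟨F, hF3, h, hh, rfl⟩, F, ?_, by ring⟩
  rintro w ⟨f, hf, h', hh', rfl⟩
  have := S.add_mem (hF2 f hf.1) (memZ_coe H hh')
  convert this using 1; ring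

theorem xmem (S : SU H p q D v u W x y z) : memZ H x :=
  (S.hmem _).2 ⟨1, 0, 0, by omega, by omega, by omega, by ring⟩
theorem ymem (S : SU H p q D v u W x y z) : memZ H y :=
  (S.hmem _).2 ⟨0, 1, 0, by omega, by omega, by omega, by ring⟩
theorem zmem (S : SU H p q D v u W x y z) : memZ H z :=
  (S.hmem _).2 ⟨0, 0, 1, by omega, by omega, by omega, by ring⟩

theorem ypos (S : SU H p q D v u W x y z) : 0 < y := by
  have := S.xpos; have := S.hD; have := S.hq
  rw [S.hy]; positivity
theorem zpos (S : SU H p q D v u W x y z) : 0 < z := by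
  have := S.xpos; have := S.hD; have := S.hq; have := S.hp
  rw [S.hz]; positivity
theorem xley (S : SU H p q D v u W x y z) : x ≤ y := by
  have := S.hD; have := S.hq
  rw [S.hy]; nlinarith
theorem xlez (S : SU H p q D v u W x y z) : x ≤ z := by
  have := S.hD; have := S.hq; have := S.hp
  rw [S.hz]; nlinarith

theorem memZ_nonzero (S : SU H p q D v u W x y z) {n : ℤ} (hn : memZ H n) (h0 : n ≠ 0) :
    memZ H (n - x) ∨ memZ H (n - y) ∨ memZ H (n - z) := by
  rw [S.hmem] at hn
  obtain ⟨s, t, r, h1, h2, h3, rfl⟩ := hn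
  by_cases hs : 1 ≤ s
  · exact Or.inl ((S.hmem _).2 ⟨s - 1, t, r, by omega, by omega, by omega, by ring⟩)
  by_cases ht : 1 ≤ t
  · exact Or.inr (Or.inl ((S.hmem _).2 ⟨s, t - 1, r, by omega, by omega, by omega, by ring⟩))
  by_cases hr : 1 ≤ r
  · exact Or.inr (Or.inr ((S.hmem _).2 ⟨s, t, r - 1, by omega, by omega, by omega, by ring⟩))
  exfalso
  apply h0
  rw [show s = 0 by omega, show t = 0 by omega, show r = 0 by omega]; ring

theorem min_ge (S : SU H p q D v u W x y z) {n : ℤ} (hn : memZ H n) (h0 : n ≠ 0) : x ≤ n := by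
  have := S.xley; have := S.xlez
  rcases S.memZ_nonzero hn h0 with h | h | h <;> have := nonneg_mem h <;> omega

theorem pf_of (S : SU H p q D v u W x y z) {f : ℤ} (h0 : ¬ memZ H f) (h1 : memZ H (f + x))
    (h2 : memZ H (f + y)) (h3 : memZ H (f + z)) : f ∈ pseudoFrob H := by
  refine ⟨h0, fun m hm hm0 => ?_⟩
  rcases S.memZ_nonzero (memZ_coe H hm) (by omega) with h | h | h
  · convert S.add_mem h1 h using 1; ring
  · convert S.add_mem h2 h using 1; ring
  · convert S.add_mem h3 h using 1; ring

theorem pf_add {f n : ℤ} (hf : f ∈ pseudoFrob H) (hn : memZ H n) (h0 : n ≠ 0) :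
    memZ H (f + n) := by
  obtain ⟨m, hm, rfl⟩ := hn
  exact hf.2 m hm (by simpa using h0)

/-- first pseudo-Frobenius number -/
theorem pf1 (S : SU H p q D v u W x y z) (hv : 1 ≤ v) :
    (-1) * x + (p + q - 1) * y + (W - q - 1) * z ∈ pseudoFrob H := by
  have := S.hp; have := S.hq; have := S.hW; have := S.hvc; have := S.hu
  have A := S.relA
  have B := S.relB
  apply S.pf_of
  · exact S.not_mem (by omega) ⟨by omega, by omega, by omega, by omega, by omega⟩
  · exact (S.hmem _).2 ⟨0, p + q - 1, W - q - 1, by omega, by omega, by omega, by ring⟩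
  · exact (S.hmem _).2 ⟨p - 1, 0, W - 1, by omega, by omega, by omega, by linear_combination A⟩
  · exact (S.hmem _).2 ⟨u + p - 1, v - 1, 0, by omega, by omega, by omega, by
      linear_combination A + B⟩

theorem pf2 (S : SU H p q D v u W x y z) :
    (-1) * x + (p + q - v - 1) * y + (W - 1) * z ∈ pseudoFrob H := by
  have := S.hp; have := S.hq; have := S.hW; have := S.hvc; have := S.hu; have := S.hv
  have A := S.relA
  have B := S.relB
  apply S.pf_of
  · exact S.not_mem (by omega) ⟨by omega, by omega, by omega, by omega, by omega⟩
  · exact (S.hmem _).2 ⟨0, p + q - v - 1, W - 1, by omega, by omega, by omega, by ring⟩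
  · exact (S.hmem _).2 ⟨u + p - 1, 0, q - 1, by omega, by omega, by omega, by
      linear_combination A + B⟩
  · exact (S.hmem _).2 ⟨u - 1, p + q - 1, 0, by omega, by omega, by omega, by
      linear_combination B⟩

theorem pf_cases (S : SU H p q D v u W x y z) (hv : 1 ≤ v) {f : ℤ} (hf : f ∈ pseudoFrob H) :
    f = (-1) * x + (p + q - 1) * y + (W - q - 1) * z ∨
    f = (-1) * x + (p + q - v - 1) * y + (W - 1) * z := by
  have := S.hp; have := S.hq; have := S.hW; have := S.hvc
  obtain ⟨s, t, r, hh, e⟩ := S.nf f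
  have h0 : ¬ 0 ≤ s := by
    have := hf.1
    rw [e, S.mem_iff hh] at this; exact this
  have h1 : 0 ≤ s + 1 := by
    have := pf_add hf S.xmem S.xpos.ne'
    rw [e, show s * x + t * y + r * z + x = (s + 1) * x + t * y + r * z by ring,
      S.mem_iff hh] at this
    exact this
  have h2 : ¬ Nrm p q v W (t + 1) r := by
    intro hc
    have := pf_add hf S.ymem S.ypos.ne'
    rw [e, show s * x + t * y + r * z + y = s * x + (t + 1) * y + r * z by ring,
      S.mem_iff hc] at this
    omega
  have h3 : ¬ Nrm p q v W t (r + 1) := by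
    intro hc
    have := pf_add hf S.zmem S.zpos.ne'
    rw [e, show s * x + t * y + r * z + z = s * x + t * y + (r + 1) * z by ring,
      S.mem_iff hc] at this
    omega
  have hs : s = -1 := by omega
  unfold Nrm at *
  have : (t = p + q - 1 ∧ r = W - q - 1) ∨ (t = p + q - v - 1 ∧ r = W - 1) := by omega
  rcases this with ⟨rfl, rfl⟩ | ⟨rfl, rfl⟩
  · left; rw [e, hs]
  · right; rw [e, hs]

/-- elements of the trace, `δ = q z - v y` -/
theorem trace_sub (S : SU H p q D v u W x y z) (hv : 1 ≤ v) {n : ℤ} (hn : n ∈ trace H) :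
    ∃ h e : ℤ, memZ H h ∧ memZ H e ∧ n = h + e ∧
      (memZ H (e + (q * z - v * y)) ∨ memZ H (e - (q * z - v * y))) := by
  obtain ⟨w, ⟨f, hf, h, hh, rfl⟩, g, hg, rfl⟩ := hn
  have h0 : (0 : ℕ) ∈ H := by
    obtain ⟨m, hm, e⟩ := (S.hmem 0).2 ⟨0, 0, 0, le_rfl, le_rfl, le_rfl, by ring⟩
    have : m = 0 := by omega
    rwa [this] at hm
  have k1 : memZ H (g + -((-1) * x + (p + q - 1) * y + (W - q - 1) * z)) :=
    hg _ ⟨_, S.pf1 hv, 0, h0, by simp⟩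
  have k2 : memZ H (g + -((-1) * x + (p + q - v - 1) * y + (W - 1) * z)) :=
    hg _ ⟨_, S.pf2, 0, h0, by simp⟩
  rcases S.pf_cases hv hf with e | e
  · refine ⟨h, g - f, memZ_coe H hh, ?_, by ring, Or.inr ?_⟩
    · rw [e, sub_eq_add_neg]; exact k1
    · rw [e]; convert k2 using 1; ring
  · refine ⟨h, g - f, memZ_coe H hh, ?_, by ring, Or.inl ?_⟩
    · rw [e, sub_eq_add_neg]; exact k2
    · rw [e]; convert k1 using 1; ring

theorem gen_of_trace (S : SU H p q D v u W x y z) (hv : 1 ≤ v) {n : ℤ} (hn : n ∈ trace H)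
    (hlt : n < 2 * x) :
    (memZ H (n + (q * z - v * y)) ∨ memZ H (n - (q * z - v * y))) := by
  have := S.hp; have := S.hq; have := S.hW; have := S.hvc; have := S.hu
  have A := S.relA
  have B := S.relB
  obtain ⟨h, e, hh, he, rfl, hd⟩ := S.trace_sub hv hn
  by_cases h0 : h = 0
  · subst h0; simpa using hd
  by_cases e0 : e = 0
  · exfalso
    subst e0
    rcases hd with hd | hd
    · have : ¬ memZ H ((-p) * x + (p + q - v) * y + 0 * z) :=
        S.not_mem (by omega) ⟨by omega, by omega, by omega, by omega, by omega⟩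
      apply this; convert hd using 1; linear_combination A
    · have : ¬ memZ H ((-u) * x + 0 * y + (W - q) * z) :=
        S.not_mem (by omega) ⟨by omega, by omega, by omega, by omega, by omega⟩
      apply this; convert hd using 1; linear_combination B
  · have := S.min_ge hh h0
    have := S.min_ge he e0
    omega

theorem ng_forward (S : SU H p q D v u W x y z) (hv : 1 ≤ v) (hng : NearlyGorenstein H) :
    p = 1 ∧ q = 1 := by
  have := S.hp; have := S.hq; have := S.hW; have := S.hvc; have := S.hu
  have A := S.relA
  have B := S.relB
  have tr : ∀ n, memZ H n → 0 < n → n ∈ trace H := by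
    rintro n ⟨m, hm, rfl⟩ h0
    exact hng m hm (by omega)
  constructor
  · by_contra hp
    rcases S.gen_of_trace hv (tr x S.xmem S.xpos) (by have := S.xpos; omega) with hd | hd
    · have : ¬ memZ H ((1 - p) * x + (p + q - v) * y + 0 * z) :=
        S.not_mem (by omega) ⟨by omega, by omega, by omega, by omega, by omega⟩
      apply this; convert hd using 1; linear_combination A
    · have : ¬ memZ H ((1 - u) * x + 0 * y + (W - q) * z) :=
        S.not_mem (by omega) ⟨by omega, by omega, by omega, by omega, by omega⟩
      apply this; convert hd using 1; linear_combination B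
  · by_contra hq
    rcases S.gen_of_trace hv (tr z S.zmem S.zpos) S.hz2 with hd | hd
    · have : ¬ memZ H ((-p) * x + (p + q - v) * y + 1 * z) :=
        S.not_mem (by omega) ⟨by omega, by omega, by omega, by omega, by omega⟩
      apply this; convert hd using 1; linear_combination A
    · have : ¬ memZ H ((-u) * x + 0 * y + (W - q + 1) * z) :=
        S.not_mem (by omega) ⟨by omega, by omega, by omega, by omega, by omega⟩
      apply this; convert hd using 1; linear_combination B

theorem mem_trace_of (S : SU H p q D v u W x y z) (hv : 1 ≤ v) {n e h : ℤ} (he : memZ H e)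
    (hh : memZ H h) (hn : n = h + e)
    (hd : memZ H (e + (q * z - v * y)) ∨ memZ H (e - (q * z - v * y))) : n ∈ trace H := by
  obtain ⟨h, hh, rfl⟩ := hh
  rcases hd with hd | hd
  · refine ⟨_, ⟨_, S.pf2, h, hh, rfl⟩,
      e + ((-1) * x + (p + q - v - 1) * y + (W - 1) * z), ?_, by rw [hn]; ring⟩
    rintro w ⟨f, hf, k, hk, rfl⟩
    rcases S.pf_cases hv hf with rfl | rfl
    · convert S.add_mem hd (memZ_coe H hk) using 1; ring
    · convert S.add_mem he (memZ_coe H hk) using 1; ring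
  · refine ⟨_, ⟨_, S.pf1 hv, h, hh, rfl⟩,
      e + ((-1) * x + (p + q - 1) * y + (W - q - 1) * z), ?_, by rw [hn]; ring⟩
    rintro w ⟨f, hf, k, hk, rfl⟩
    rcases S.pf_cases hv hf with rfl | rfl
    · convert S.add_mem he (memZ_coe H hk) using 1; ring
    · convert S.add_mem hd (memZ_coe H hk) using 1; ring

theorem ng_backward (S : SU H p q D v u W x y z) (hv : 1 ≤ v) (hp : p = 1) (hq : q = 1) :
    NearlyGorenstein H := by
  have A := S.relA
  have hv1 : v = 1 := by have := S.hvc; omega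
  subst hp hq hv1
  intro h hh h0
  rcases S.memZ_nonzero (memZ_coe H hh) (by omega) with k | k | k
  · refine S.mem_trace_of hv S.xmem k (by ring) (Or.inl ?_)
    convert S.ymem using 1; linear_combination -A
  · refine S.mem_trace_of hv S.ymem k (by ring) (Or.inl ?_)
    convert S.zmem using 1; ring
  · refine S.mem_trace_of hv S.zmem k (by ring) (Or.inr ?_)
    convert S.ymem using 1; ring

theorem ng_iff (S : SU H p q D v u W x y z) :
    NearlyGorenstein H ↔ v = 0 ∨ (p = 1 ∧ q = 1) := by
  have := S.hv
  by_cases hv : v = 0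
  · exact ⟨fun _ => Or.inl hv, fun _ => S.sym hv⟩
  · constructor
    · intro h
      exact Or.inr (S.ng_forward (by omega) h)
    · rintro (h | h)
      · exact absurd h hv
      · exact S.ng_backward (by omega) h.1 h.2

end SU

theorem mem_genBy_three (x y z n : ℕ) :
    n ∈ genBy {x, y, z} ↔ ∃ s t r : ℕ, n = s * x + t * y + r * z := by
  unfold genBy
  constructor
  · intro h
    induction h using AddSubmonoid.closure_induction with
    | mem a ha =>
      rcases ha with rfl | rfl | rfl
      · exact ⟨1, 0, 0, by ring⟩
      · exact ⟨0, 1, 0, by ring⟩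
      · exact ⟨0, 0, 1, by ring⟩
    | zero => exact ⟨0, 0, 0, by ring⟩
    | add a b _ _ h1 h2 =>
      obtain ⟨s, t, r, rfl⟩ := h1
      obtain ⟨s', t', r', rfl⟩ := h2
      exact ⟨s + s', t + t', r + r', by ring⟩
  · rintro ⟨s, t, r, rfl⟩
    have key : ∀ a ∈ ({x, y, z} : Set ℕ), ∀ k : ℕ, k * a ∈ AddSubmonoid.closure {x, y, z} := by
      intro a ha k
      have := (AddSubmonoid.closure {x, y, z}).nsmul_mem (AddSubmonoid.subset_closure ha) k
      simpa using this
    exact add_mem (add_mem (key x (by simp) s) (key y (by simp) t)) (key z (by simp) r)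

theorem memZ_divGcd (g x y z : ℕ) (hg : 0 < g) (hx : 0 < x)
    (hcop : ∀ d, d ∣ x → d ∣ y → d ∣ z → d = 1) (n : ℤ) :
    memZ (divGcd (genBy {g * x, g * y, g * z})) n ↔
      ∃ s t r : ℤ, 0 ≤ s ∧ 0 ≤ t ∧ 0 ≤ r ∧ n = s * x + t * y + r * z := by
  have hgcd : gcdSet (genBy {g * x, g * y, g * z}) = g := by
    have hone : Nat.gcd x (Nat.gcd y z) = 1 := hcop _ (Nat.gcd_dvd_left _ _)
      ((Nat.gcd_dvd_right _ _).trans (Nat.gcd_dvd_left _ _))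
      ((Nat.gcd_dvd_right _ _).trans (Nat.gcd_dvd_right _ _))
    apply IsGreatest.csSup_eq
    constructor
    · intro s hs
      obtain ⟨s, t, r, rfl⟩ := (mem_genBy_three _ _ _ _).1 hs
      exact ⟨s * x + t * y + r * z, by ring⟩
    · intro d hd
      have h1 : d ∣ g * x := hd _ ((mem_genBy_three _ _ _ _).2 ⟨1, 0, 0, by ring⟩)
      have h2 : d ∣ g * y := hd _ ((mem_genBy_three _ _ _ _).2 ⟨0, 1, 0, by ring⟩)
      have h3 : d ∣ g * z := hd _ ((mem_genBy_three _ _ _ _).2 ⟨0, 0, 1, by ring⟩)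
      have := Nat.dvd_gcd h1 (Nat.dvd_gcd h2 h3)
      rw [Nat.gcd_mul_left, Nat.gcd_mul_left, hone, mul_one] at this
      exact Nat.le_of_dvd hg this
  unfold memZ divGcd
  rw [hgcd]
  constructor
  · rintro ⟨m, ⟨m', hm', rfl⟩, rfl⟩
    obtain ⟨s, t, r, rfl⟩ := (mem_genBy_three _ _ _ _).1 hm'
    refine ⟨s, t, r, by omega, by omega, by omega, ?_⟩
    rw [show s * (g * x) + t * (g * y) + r * (g * z) = g * (s * x + t * y + r * z) by ring]
    simp only [Nat.mul_div_cancel_left _ hg]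
    push_cast; ring
  · rintro ⟨s, t, r, hs, ht, hr, rfl⟩
    lift s to ℕ using hs
    lift t to ℕ using ht
    lift r to ℕ using hr
    refine ⟨s * x + t * y + r * z, ⟨g * (s * x + t * y + r * z),
      (mem_genBy_three _ _ _ _).2 ⟨s, t, r, by ring⟩, ?_⟩, by push_cast; ring⟩
    simp only [Nat.mul_div_cancel_left _ hg]

/-- building the data -/
theorem mkSU (g p q D j : ℕ) (v W : ℤ) (hg : 0 < g) (hp : 1 ≤ p) (hq : 1 ≤ q) (hD : 1 ≤ D)
    (hpq : Nat.Coprime p q) (hjD : Nat.Coprime j D)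
    (hv : 0 ≤ v) (hvc : v < p + q) (hW : (j : ℤ) + v * q = (p + q) * W)
    (hb1 : 2 * (D * (p + q) * q) < j) (hb2 : 2 * (D * (p + q) * (p - 1)) < j) :
    SU (divGcd (genBy {g * j, g * (j + D * q), g * (j + D * (p + q))})) p q D v (D - v + W) W
      j (j + D * q : ℕ) (j + D * (p + q) : ℕ) := by
  have hj : 0 < j := by omega
  have c1 : 2 * ((D : ℤ) * (p + q) * q) < j := by exact_mod_cast hb1
  have c2 : 2 * ((D : ℤ) * (p + q) * (p - 1)) < j := by
    have := Int.ofNat_lt.2 hb2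
    push_cast [Nat.cast_sub hp] at this
    exact this
  have hp' : (1 : ℤ) ≤ p := by exact_mod_cast hp
  have hq' : (1 : ℤ) ≤ q := by exact_mod_cast hq
  have hD' : (1 : ℤ) ≤ D := by exact_mod_cast hD
  have hvq : 0 ≤ v * q := by positivity
  have w1 : 2 * ((D : ℤ) * q) < W := by
    have : ((p : ℤ) + q) * (2 * (D * q)) < (p + q) * W := by rw [← hW]; nlinarith
    exact lt_of_mul_lt_mul_left this (by omega)
  have w2 : 2 * ((D : ℤ) * (p - 1)) < W := by
    have : ((p : ℤ) + q) * (2 * (D * (p - 1))) < (p + q) * W := by rw [← hW]; nlinarith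
    exact lt_of_mul_lt_mul_left this (by omega)
  have d1 : (q : ℤ) ≤ D * q := by nlinarith
  have d2 : (p : ℤ) - 1 ≤ D * (p - 1) := by nlinarith
  refine ⟨hp', hq', hD', hv, hvc, by omega, by omega, by linarith, rfl, by push_cast; ring,
    by push_cast; ring, Nat.isCoprime_iff_coprime.2 hpq, Nat.isCoprime_iff_coprime.2 hjD, ?_, ?_⟩
  · push_cast
    nlinarith [mul_pos (show (0 : ℤ) < D by omega) (show (0 : ℤ) < p + q by omega)]
  · apply memZ_divGcd g j _ _ hg hj
    intro d h1 h2 h3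
    have e2 : d ∣ D * q := (Nat.dvd_add_right h1).1 h2
    have e3 : d ∣ D * (p + q) := (Nat.dvd_add_right h1).1 h3
    have hdD : Nat.Coprime d D := Nat.Coprime.coprime_dvd_left h1 hjD
    have f2 := hdD.dvd_of_dvd_mul_left e2
    have f3 := hdD.dvd_of_dvd_mul_left e3
    have f4 := (Nat.dvd_add_left f2).1 f3
    exact Nat.eq_one_of_dvd_coprimes hpq f4 f2

theorem stmt_15 (a b : ℕ) (ha : 0 < a) (hab : a < b)
    (D k : ℕ) (hD : D = Nat.gcd a b)
    (hk : k = max (b * ((b - a) / D - 1)) (a * b / D)) :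
    ∀ j : ℕ, 1 ≤ j → 2 * k < j →
      (NearlyGorenstein (divGcd (genBy {j, j + a, j + b})) ↔
        NearlyGorenstein (divGcd (genBy {j + b, j + b + a, j + b + b}))) := by
  intro j hj hkj
  have hD0 : 0 < D := by rw [hD]; exact Nat.gcd_pos_of_pos_left _ ha
  obtain ⟨q, c, hqc, hqa, hcb⟩ : ∃ q c, Nat.Coprime q c ∧ a = D * q ∧ b = D * c := by
    obtain ⟨q, c, h1, h2, h3⟩ := Nat.exists_coprime a b
    exact ⟨q, c, h1, by rw [hD]; linarith, by rw [hD]; linarith⟩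
  obtain ⟨j', D', hjD, hj1, hD1⟩ : ∃ j' D', Nat.Coprime j' D' ∧ j = Nat.gcd j D * j' ∧
      D = Nat.gcd j D * D' := by
    obtain ⟨q, c, h1, h2, h3⟩ := Nat.exists_coprime j D
    exact ⟨q, c, h1, by linarith, by linarith⟩
  have hg : 0 < Nat.gcd j D := Nat.gcd_pos_of_pos_left _ hj
  generalize Nat.gcd j D = g at *
  have hq : 1 ≤ q := by
    rcases Nat.eq_zero_or_pos q with h | h
    · subst h; simp at hqa; omega
    · exact h
  have hqltc : q < c := by
    rw [hqa, hcb] at hab; exact lt_of_mul_lt_mul_left hab (by omega)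
  obtain ⟨p, rfl⟩ : ∃ p, c = p + q := ⟨c - q, by omega⟩
  have hp : 1 ≤ p := by omega
  have hpq : Nat.Coprime p q := by
    have := hqc.symm; simpa using this
  have hD'0 : 1 ≤ D' := by
    rcases Nat.eq_zero_or_pos D' with h | h
    · subst h; simp at hD1; omega
    · exact h
  have k1 : (b - a) / D = p := by
    rw [hqa, hcb, ← Nat.mul_sub, Nat.mul_div_cancel_left _ hD0]; omega
  have k2 : a * b / D = D * (p + q) * q := by
    rw [hqa, hcb, show D * q * (D * (p + q)) = D * (D * (p + q) * q) by ring,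
      Nat.mul_div_cancel_left _ hD0]
  rw [k1, k2] at hk
  have b1 : 2 * (D' * (p + q) * q) < j' := by
    have : D * (p + q) * q ≤ k := by rw [hk]; exact le_max_right _ _
    have h : g * (2 * (D' * (p + q) * q)) < g * j' := by
      rw [← hj1]
      calc g * (2 * (D' * (p + q) * q)) = 2 * ((g * D') * (p + q) * q) := by ring
        _ = 2 * (D * (p + q) * q) := by rw [← hD1]
        _ < j := by omega
    exact lt_of_mul_lt_mul_left h (by omega)
  have b2 : 2 * (D' * (p + q) * (p - 1)) < j' := by
    have : b * (p - 1) ≤ k := by rw [hk]; exact le_max_left _ _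
    have h : g * (2 * (D' * (p + q) * (p - 1))) < g * j' := by
      rw [← hj1]
      calc g * (2 * (D' * (p + q) * (p - 1))) = 2 * ((g * D') * (p + q) * (p - 1)) := by ring
        _ = 2 * (b * (p - 1)) := by rw [← hD1, ← hcb]
        _ < j := by omega
    exact lt_of_mul_lt_mul_left h (by omega)
  obtain ⟨v, W, hv, hvc, hW⟩ : ∃ v W : ℤ, 0 ≤ v ∧ v < p + q ∧
      (j' : ℤ) + v * q = (p + q) * W := by
    have hcz : (0 : ℤ) < p + q := by omega
    obtain ⟨α, β, h⟩ : IsCoprime (q : ℤ) ((p + q : ℕ) : ℤ) := Nat.isCoprime_iff_coprime.2 hqc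
    push_cast at h
    have d := Int.emod_add_mul_ediv (-(j' * α)) ((p : ℤ) + q)
    refine ⟨(-(j' * α)) % (p + q), j' * β - (-(j' * α)) / (p + q) * q,
      Int.emod_nonneg _ hcz.ne', Int.emod_lt_of_pos _ hcz, ?_⟩
    linear_combination q * d - j' * h
  have S1 := mkSU g p q D' j' v W hg hp hq hD'0 hpq hjD hv hvc hW b1 b2
  have S2 := mkSU g p q D' (j' + D' * (p + q)) v (W + D') hg hp hq hD'0 hpq
    (by simpa using hjD) hv hvc (by push_cast; linear_combination hW) (by omega) (by omega)
  have ea : a = g * (D' * q) := by rw [hqa, ← mul_assoc, ← hD1]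
  have eb : b = g * (D' * (p + q)) := by rw [hcb, ← mul_assoc, ← hD1]
  have r1 := S1.ng_iff
  have r2 := S2.ng_iff
  rw [show j + a = g * (j' + D' * q) by rw [ea, hj1]; ring,
    show j + b + a = g * (j' + D' * (p + q) + D' * q) by rw [ea, eb, hj1]; ring,
    show j + b + b = g * (j' + D' * (p + q) + D' * (p + q)) by
      rw [eb, hj1]; ring,
    show j + b = g * (j' + D' * (p + q)) by rw [eb, hj1]; ring]
  rw [← hj1] at r1
  rw [r1, r2]
end
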